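/- Let $F_1, F_2 : S^2 \to \mathbb{R}^3$ be smooth immersions with the same induced metric and the same mean curvature (a Bonnet pair of spherical topology). Then $F_1$ and $F_2$ are congruent, i.e. they differ by a rigid motion of $\mathbb{R}^3$. -/

import Mathlib

/-!
Statement 2: a Bonnet pair of spherical topology is trivial: two smooth immersions of `S²`
into `ℝ³` with the same induced metric and the same mean curvature are congruent, i.e.
differ by a rigid motion (an isometry of Euclidean `ℝ³`).
An immersion of `S²` is represented by a smooth map on a neighborhood of the standard unit
sphere in `ℝ³` (every smooth immersion of `S²` arises this way), restricted to the sphere.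
-/

noncomputable section
open scoped RealInnerProductSpace

/-- Euclidean 3-space. -/
abbrev E3 := EuclideanSpace ℝ (Fin 3)

/-- The standard unit 2-sphere `S² ⊂ ℝ³`. -/
def S2 : Set E3 := Metric.sphere (0 : E3) 1

/-- `v` is tangent to the standard sphere at `x ∈ S²`. -/
def Tang (x v : E3) : Prop := ⟪x, v⟫ = 0

/-- Differential of `F` at `x`. -/
def dF (F : E3 → E3) (x : E3) : E3 →L[ℝ] E3 := fderiv ℝ F x

/-- Metric on `S²` induced by `F` (pullback of the Euclidean metric): a smooth map on a
neighborhood of the sphere represents a map of `S²` by restriction. -/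
def inducedMetric (F : E3 → E3) (x v w : E3) : ℝ := ⟪dF F x v, dF F x w⟫

/-- `F` restricts to a smooth immersion of the standard sphere `S²` into `ℝ³`. -/
def IsImmersionOnSphere (F : E3 → E3) : Prop :=
  ContDiff ℝ (⊤ : ℕ∞) F ∧ ∀ x ∈ S2, ∀ v : E3, Tang x v → v ≠ 0 → dF F x v ≠ 0

/-- `ν` is a unit normal vector of the immersed surface `F(S²)` at `x ∈ S²`. -/
def IsUnitNormalAt (F : E3 → E3) (x ν : E3) : Prop :=
  ‖ν‖ = 1 ∧ ∀ v : E3, Tang x v → ⟪ν, dF F x v⟫ = 0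

/-- Second fundamental form of the immersion `F|_{S²}` at `x ∈ S²` with respect to the unit
normal `ν`, evaluated on tangent vectors `v, w` of `S²` at `x`: the normal component of the
intrinsic second derivative of `F` along the sphere (the term `⟪v,w⟫ • dF F x x` accounts for
the curvature of the parametrizing sphere). -/
def sff (F : E3 → E3) (x ν v w : E3) : ℝ :=
  ⟪ν, (fderiv ℝ (fun y => fderiv ℝ F y v) x) w - ⟪v, w⟫ • dF F x x⟫

/-- The trace of the bilinear form `A` with respect to the positive-definite bilinear form
`γ` on a 2-plane, computed in the basis `b₁, b₂`. -/
def traceFormula (γ A : E3 → E3 → ℝ) (b₁ b₂ : E3) : ℝ :=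
  (γ b₁ b₁ * A b₂ b₂ + γ b₂ b₂ * A b₁ b₁ - 2 * γ b₁ b₂ * A b₁ b₂) /
    (γ b₁ b₁ * γ b₂ b₂ - (γ b₁ b₂) ^ 2)

/-- `h` is the mean curvature at `x ∈ S²` of the immersion `F|_{S²}` with respect to the unit
normal `ν`: the trace of the second fundamental form with respect to the induced metric
(computed in any orthonormal tangent basis of the round sphere at `x`). -/
def IsMeanCurvAt (F : E3 → E3) (x ν : E3) (h : ℝ) : Prop :=
  IsUnitNormalAt F x ν ∧ ∀ b₁ b₂ : E3, Tang x b₁ → Tang x b₂ →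
    ⟪b₁, b₂⟫ = 0 → ‖b₁‖ = 1 → ‖b₂‖ = 1 →
    h = traceFormula (inducedMetric F x) (sff F x ν) b₁ b₂

namespace BP
open MeasureTheory Filter Topology

/-- The parameter plane. -/
abbrev P2 := ℝ × ℝ

def e1 : P2 := (1, 0)
def e2 : P2 := (0, 1)

section basic
variable {V : Type*} [NormedAddCommGroup V] [NormedSpace ℝ V]

/-- Smooth. -/
abbrev Sm (f : P2 → V) : Prop := ContDiff ℝ (⊤ : ℕ∞) f

/-- Partial derivative. -/
def pd (v : P2) (f : P2 → V) (z : P2) : V := fderiv ℝ f z v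

lemma Sm.da {f : P2 → V} (h : Sm f) (z : P2) : DifferentiableAt ℝ f z :=
  (h.differentiable (by simp)) z

lemma Sm.pd {f : P2 → V} (h : Sm f) (v : P2) : Sm (pd v f) := by
  have : ContDiff ℝ (⊤ : ℕ∞) (fderiv ℝ f) := h.fderiv_right (by simp)
  exact this.clm_apply contDiff_const

lemma pd_comm {f : P2 → V} (h : Sm f) (v w : P2) (z : P2) : pd v (pd w f) z = pd w (pd v f) z := by
  have h1 : ContDiff ℝ (⊤ : ℕ∞) (fderiv ℝ f) := h.fderiv_right (by simp)
  have h2 : DifferentiableAt ℝ (fderiv ℝ f) z := (h1.differentiable (by simp)) z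
  have hs : IsSymmSndFDerivAt ℝ f z := by
    apply (h.contDiffAt).isSymmSndFDerivAt
    rw [minSmoothness_of_isRCLikeNormedField]
    exact WithTop.coe_le_coe.2 le_top
  have key : ∀ v w : P2, pd v (pd w f) z = fderiv ℝ (fderiv ℝ f) z v w := by
    intro v w
    unfold pd
    rw [fderiv_clm_apply h2 (differentiableAt_const w)]
    simp
  rw [key, key]
  exact hs v w

lemma pd_add {f g : P2 → V} (hf : Sm f) (hg : Sm g) (v z : P2) :
    pd v (fun z => f z + g z) z = pd v f z + pd v g z := by
  unfold pd; rw [fderiv_fun_add (hf.da z) (hg.da z)]; rfl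

lemma pd_sub {f g : P2 → V} (hf : Sm f) (hg : Sm g) (v z : P2) :
    pd v (fun z => f z - g z) z = pd v f z - pd v g z := by
  unfold pd; rw [fderiv_fun_sub (hf.da z) (hg.da z)]; rfl

lemma pd_mul {f g : P2 → ℝ} (hf : Sm f) (hg : Sm g) (v z : P2) :
    pd v (fun z => f z * g z) z = pd v f z * g z + f z * pd v g z := by
  unfold pd; rw [fderiv_fun_mul (hf.da z) (hg.da z)]; simp; ring

lemma pd_inv {f : P2 → ℝ} (hf : Sm f) (v z : P2) (h0 : f z ≠ 0) :
    pd v (fun z => (f z)⁻¹) z = - pd v f z / f z ^ 2 := by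
  unfold pd
  have : fderiv ℝ (fun z => (f z)⁻¹) z = _ :=
    ((hasDerivAt_inv h0).comp_hasFDerivAt z (hf.da z).hasFDerivAt).fderiv
  rw [this]
  simp; ring

lemma pd_const (c : V) (v z : P2) : pd v (fun _ => c) z = 0 := by
  simp [pd]

lemma integral_pd_eq_zero {f : P2 → ℝ} (hf : Sm f) (hc : HasCompactSupport f) (v : P2) :
    ∫ z, pd v f z = 0 := by
  have hc' : HasCompactSupport (pd v f) := by
    have := hc.fderiv (𝕜 := ℝ)
    exact this.comp_left (g := fun (L : P2 →L[ℝ] ℝ) => L v) (by simp)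
  have hint : Integrable (fun z => fderiv ℝ f z v) :=
    (hf.pd v).continuous.integrable_of_hasCompactSupport hc'
  have := integral_smul_fderiv_eq_neg_fderiv_smul_of_integrable (𝕜 := ℝ) (μ := (volume : Measure P2))
    (f := fun _ : P2 => (1 : ℝ)) (g := f) (v := v) (by simp) (by simpa using hint)
    (by simpa using hf.continuous.integrable_of_hasCompactSupport hc)
    (by simp) (fun x _ => hf.da x)
  simpa [pd] using this

end basic

/-- The winding lemma. -/
lemma winding_contra {a b : P2 → ℝ} (ha : Sm a) (hb : Sm b) {R C : ℝ} (hR : 0 < R)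
    (hC : ∀ z : P2, z.1 ^ 2 + z.2 ^ 2 ≤ R + 1 →
      pd e1 a z * pd e2 b z - pd e2 a z * pd e1 b z ≤ C * (a z ^ 2 + b z ^ 2))
    (hpos : ∀ z : P2, R ≤ z.1 ^ 2 + z.2 ^ 2 →
      0 < a z * (z.1 * pd e2 b z - z.2 * pd e1 b z) - b z * (z.1 * pd e2 a z - z.2 * pd e1 a z)) :
    False := by
  classical
  -- cutoff
  set h : ℝ → ℝ := fun s => Real.smoothTransition (R + 1 - s) with hh
  have hsm : ContDiff ℝ (⊤ : ℕ∞) h :=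
    Real.smoothTransition.contDiff.comp (contDiff_const.sub contDiff_id)
  have hanti : Antitone h := fun s t hst => Real.smoothTransition.monotone (by linarith)
  have h' : ∀ s, deriv h s ≤ 0 := fun s => hanti.deriv_nonpos
  have h1 : ∀ s, s ≤ R → h s = 1 := fun s hs => Real.smoothTransition.one_of_one_le (by linarith)
  have h0 : ∀ s, R + 1 ≤ s → h s = 0 := fun s hs => Real.smoothTransition.zero_of_nonpos (by linarith)
  have hd1 : ∀ s, s < R → deriv h s = 0 := by
    intro s hs
    have : h =ᶠ[𝓝 s] fun _ => 1 := by
      filter_upwards [Iio_mem_nhds hs] with t ht using h1 t ht.le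
    rw [this.deriv_eq]; simp
  have hd0 : ∀ s, R + 1 < s → deriv h s = 0 := by
    intro s hs
    have : h =ᶠ[𝓝 s] fun _ => 0 := by
      filter_upwards [Ioi_mem_nhds hs] with t ht using h0 t (le_of_lt ht)
    rw [this.deriv_eq]; simp
  obtain ⟨s0, hs0, hs0'⟩ : ∃ s0 ∈ Set.Ioo R (R + 1), deriv h s0 = (h (R + 1) - h R) / (R + 1 - R) :=
    exists_deriv_eq_slope h (by linarith) hsm.continuous.continuousOn
      (hsm.differentiable (by simp)).differentiableOn
  rw [h1 R le_rfl, h0 (R + 1) le_rfl] at hs0'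
  have hs0neg : deriv h s0 = -1 := by rw [hs0']; norm_num
  have hdsm : Continuous (deriv h) := hsm.continuous_deriv (by simp)
  set rr : P2 → ℝ := fun z => z.1 ^ 2 + z.2 ^ 2 with hrr
  have hrrsm : Sm rr := by unfold Sm; fun_prop
  set χ : P2 → ℝ := fun z => h (rr z) with hχ
  have hχsm : Sm χ := hsm.comp hrrsm
  have hχ0 : ∀ z, 0 ≤ χ z := fun z => Real.smoothTransition.nonneg _
  have hχ1 : ∀ z, χ z ≤ 1 := fun z => Real.smoothTransition.le_one _
  set K : Set P2 := Metric.closedBall 0 (R + 2) with hK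
  have hKc : IsCompact K := isCompact_closedBall _ _
  have hout : ∀ z, z ∉ K → R + 1 < rr z := by
    intro z hz
    by_contra hcon
    push Not at hcon
    apply hz
    simp only [hK, Metric.mem_closedBall, dist_zero_right, Prod.norm_def, Real.norm_eq_abs]
    simp only [hrr] at hcon
    apply max_le <;> apply abs_le_of_sq_le_sq <;> nlinarith [sq_nonneg z.1, sq_nonneg z.2]
  have hpdχ : ∀ z, pd e1 χ z = 2 * z.1 * deriv h (rr z) ∧ pd e2 χ z = 2 * z.2 * deriv h (rr z) := by
    intro z
    have hd : HasFDerivAt rr ((2 * z.1) • ContinuousLinearMap.fst ℝ ℝ ℝ +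
        (2 * z.2) • ContinuousLinearMap.snd ℝ ℝ ℝ) z := by
      have := ((hasFDerivAt_fst (𝕜 := ℝ) (p := z)).pow 2).add
        ((hasFDerivAt_snd (𝕜 := ℝ) (p := z)).pow 2)
      convert! this using 1 <;> simp
    have := ((hsm.differentiable (by simp)) (rr z)).hasDerivAt.comp_hasFDerivAt z hd
    unfold pd
    have e : fderiv ℝ χ z = _ := this.fderiv
    rw [e]
    simp [e1, e2]
    constructor <;> ring
  have hcs : ∀ g : P2 → ℝ, HasCompactSupport (fun z => χ z * g z) := by
    intro g
    apply HasCompactSupport.intro hKc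
    intro z hz
    simp [hχ, h0 _ (hout z hz).le]
  set Φ : P2 → ℝ := fun z => a z * (z.1 * pd e2 b z - z.2 * pd e1 b z)
    - b z * (z.1 * pd e2 a z - z.2 * pd e1 a z) with hΦ
  set J : P2 → ℝ := fun z => pd e1 a z * pd e2 b z - pd e2 a z * pd e1 b z with hJ
  have ca := ha.continuous
  have cb := hb.continuous
  have ca1 := (ha.pd e1).continuous
  have ca2 := (ha.pd e2).continuous
  have cb1 := (hb.pd e1).continuous
  have cb2 := (hb.pd e2).continuous
  have cχ := hχsm.continuous
  have crr := hrrsm.continuous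
  have cΦ : Continuous Φ := by rw [hΦ]; fun_prop
  have cJ : Continuous J := by rw [hJ]; fun_prop
  have cd : Continuous (fun z => deriv h (rr z)) := hdsm.comp crr
  -- the key identity
  have key : ∀ ε : ℝ, 0 < ε →
      ∫ z, (-2 * deriv h (rr z)) * (Φ z / (a z ^ 2 + b z ^ 2 + ε)) =
      ∫ z, χ z * (2 * ε * J z / (a z ^ 2 + b z ^ 2 + ε) ^ 2) := by
    intro ε hε
    set s : P2 → ℝ := fun z => a z ^ 2 + b z ^ 2 + ε with hs
    have hspos : ∀ z, 0 < s z := fun z => by simp only [hs]; positivity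
    have hssm : Sm s := by unfold Sm; fun_prop
    have hsi : Sm (fun z => (s z)⁻¹) := hssm.inv (fun z => (hspos z).ne')
    have hpds : ∀ v z, pd v s z = 2 * (a z * pd v a z + b z * pd v b z) := by
      intro v z
      have e : s = fun z => (a z * a z + b z * b z) + ε := by ext z; simp only [hs]; ring
      rw [e, pd_add (by unfold Sm; fun_prop) (by unfold Sm; fun_prop), pd_const,
        pd_add (by unfold Sm; fun_prop) (by unfold Sm; fun_prop), pd_mul ha ha, pd_mul hb hb]
      ring
    have q : ∀ v, Sm (fun z => (a z * pd v b z - b z * pd v a z) * (s z)⁻¹) := fun v =>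
      ((ha.mul (hb.pd v)).sub (hb.mul (ha.pd v))).mul hsi
    have i1 := integral_pd_eq_zero (hχsm.mul (q e2)) (hcs _) e1
    have i2 := integral_pd_eq_zero (hχsm.mul (q e1)) (hcs _) e2
    have comp : ∀ v w z, pd w (fun z => χ z * ((a z * pd v b z - b z * pd v a z) * (s z)⁻¹)) z
        = pd w χ z * ((a z * pd v b z - b z * pd v a z) * (s z)⁻¹)
        + χ z * ((pd w a z * pd v b z + a z * pd w (pd v b) z - pd w b z * pd v a z
            - b z * pd w (pd v a) z) * (s z)⁻¹ +
           (a z * pd v b z - b z * pd v a z) * (-(2 * (a z * pd w a z + b z * pd w b z)) / s z ^ 2)) := by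
      intro v w z
      rw [pd_mul hχsm (q v), pd_mul ((ha.mul (hb.pd v)).sub (hb.mul (ha.pd v))) hsi,
        pd_sub (ha.mul (hb.pd v)) (hb.mul (ha.pd v)), pd_mul ha (hb.pd v), pd_mul hb (ha.pd v),
        pd_inv hssm _ _ (hspos z).ne', hpds]
      ring
    have hcpd : ∀ v w, Integrable (pd w (fun z => χ z * ((a z * pd v b z - b z * pd v a z) * (s z)⁻¹))) := by
      intro v w
      apply (Sm.pd (hχsm.mul (q v)) w).continuous.integrable_of_hasCompactSupport
      have := (hcs (fun z => ((a z * pd v b z - b z * pd v a z) * (s z)⁻¹))).fderiv (𝕜 := ℝ)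
      exact this.comp_left (g := fun (L : P2 →L[ℝ] ℝ) => L w) (by simp)
    have i3 : ∫ z, (pd e1 (fun z => χ z * ((a z * pd e2 b z - b z * pd e2 a z) * (s z)⁻¹)) z
        - pd e2 (fun z => χ z * ((a z * pd e1 b z - b z * pd e1 a z) * (s z)⁻¹)) z) = 0 := by
      rw [integral_sub (hcpd _ _) (hcpd _ _)]
      erw [i1, i2]; simp
    have i4 : ∫ z, (χ z * (2 * ε * J z / (s z) ^ 2) - (-2 * deriv h (rr z)) * (Φ z / s z)) = 0 := by
      rw [← i3]
      congr 1
      ext z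
      rw [comp, comp, (hpdχ z).1, (hpdχ z).2, pd_comm hb e2 e1, pd_comm ha e2 e1]
      have := (hspos z).ne'
      have hε' : ε = s z - a z ^ 2 - b z ^ 2 := by simp only [hs]; ring
      simp only [hΦ, hJ]
      rw [hε']
      field_simp
      ring
    have csinv : Continuous (fun z => (s z)⁻¹) := hsi.continuous
    rw [integral_sub] at i4
    · linarith
    · apply Continuous.integrable_of_hasCompactSupport _ (hcs _)
      have : (fun z => χ z * (2 * ε * J z / s z ^ 2)) = fun z => χ z * (2 * ε * J z * (s z)⁻¹ ^ 2) := by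
        ext z; field_simp
      rw [this]; fun_prop
    · apply Continuous.integrable_of_hasCompactSupport
      · have : (fun z => -2 * deriv h (rr z) * (Φ z / s z)) =
          fun z => -2 * deriv h (rr z) * (Φ z * (s z)⁻¹) := by
          ext z; field_simp
        rw [this]; fun_prop
      · apply HasCompactSupport.intro hKc
        intro z hz
        simp [hd0 _ (hout z hz)]
  have hM : ∀ z, 0 ≤ (-2 * deriv h (rr z)) * Φ z := by
    intro z
    rcases lt_or_ge (rr z) R with hz | hz
    · simp [hd1 _ hz]
    · exact mul_nonneg (by linarith [h' (rr z)]) (hpos z hz).le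
  have hintM : ∀ ε : ℝ, 0 < ε →
      Continuous (fun z => (-2 * deriv h (rr z)) * (Φ z / (a z ^ 2 + b z ^ 2 + ε))) ∧
      HasCompactSupport (fun z => (-2 * deriv h (rr z)) * (Φ z / (a z ^ 2 + b z ^ 2 + ε))) := by
    intro ε hε
    constructor
    · have : ∀ z, a z ^ 2 + b z ^ 2 + ε ≠ 0 := fun z => by positivity
      fun_prop (disch := assumption)
    · apply HasCompactSupport.intro hKc
      intro z hz
      simp [hd0 _ (hout z hz)]
  have hc0 : 0 < ∫ z, (-2 * deriv h (rr z)) * (Φ z / (a z ^ 2 + b z ^ 2 + 1)) := by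
    obtain ⟨c1, c2⟩ := hintM 1 one_pos
    have hrs : rr (Real.sqrt s0, 0) = s0 := by
      simp only [hrr]; rw [Real.sq_sqrt (by linarith [hs0.1])]; ring
    refine c1.integral_pos_of_hasCompactSupport_nonneg_nonzero c2 (x := (Real.sqrt s0, 0)) ?_ ?_
    · intro z
      have := hM z
      show 0 ≤ (-2 * deriv h (rr z)) * (Φ z / (a z ^ 2 + b z ^ 2 + 1))
      rw [← mul_div_assoc]; positivity
    · have hp := hpos (Real.sqrt s0, 0) (hs0.1.le.trans_eq hrs.symm)
      have hp' : 0 < Φ (Real.sqrt s0, 0) := hp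
      rw [hrs, hs0neg]
      positivity
  set c0 := ∫ z, (-2 * deriv h (rr z)) * (Φ z / (a z ^ 2 + b z ^ 2 + 1)) with hc0d
  have hle : ∀ ε : ℝ, 0 < ε → ε ≤ 1 →
      c0 ≤ ∫ z, χ z * (2 * ε * (|C| * (a z ^ 2 + b z ^ 2)) / (a z ^ 2 + b z ^ 2 + ε) ^ 2) := by
    intro ε hε hε1
    have hne : ∀ z, a z ^ 2 + b z ^ 2 + ε ≠ 0 := fun z => by positivity
    have hne2 : ∀ z, (a z ^ 2 + b z ^ 2 + ε) ^ 2 ≠ 0 := fun z => by positivity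
    calc c0 ≤ ∫ z, (-2 * deriv h (rr z)) * (Φ z / (a z ^ 2 + b z ^ 2 + ε)) := by
          obtain ⟨c1, c2⟩ := hintM 1 one_pos
          obtain ⟨c3, c4⟩ := hintM ε hε
          apply integral_mono (c1.integrable_of_hasCompactSupport c2)
            (c3.integrable_of_hasCompactSupport c4)
          intro z
          have := hM z
          show (-2 * deriv h (rr z)) * (Φ z / (a z ^ 2 + b z ^ 2 + 1)) ≤
            (-2 * deriv h (rr z)) * (Φ z / (a z ^ 2 + b z ^ 2 + ε))
          rw [← mul_div_assoc, ← mul_div_assoc]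
          gcongr
      _ = _ := key ε hε
      _ ≤ _ := by
          apply integral_mono
          · apply Continuous.integrable_of_hasCompactSupport _ (hcs _)
            fun_prop (disch := assumption)
          · apply Continuous.integrable_of_hasCompactSupport _ (hcs _)
            fun_prop (disch := assumption)
          · intro z
            show χ z * (2 * ε * J z / (a z ^ 2 + b z ^ 2 + ε) ^ 2) ≤
              χ z * (2 * ε * (|C| * (a z ^ 2 + b z ^ 2)) / (a z ^ 2 + b z ^ 2 + ε) ^ 2)
            rcases le_or_gt (rr z) (R + 1) with hz | hz
            · have h3 : J z ≤ |C| * (a z ^ 2 + b z ^ 2) := (hC z hz).trans (by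
                gcongr; exact le_abs_self C)
              have := hχ0 z
              gcongr
            · simp [hχ, h0 _ hz.le]
  have hlim : Tendsto (fun n : ℕ => ∫ z, χ z * (2 * (1 / ((n : ℝ) + 1)) * (|C| * (a z ^ 2 + b z ^ 2)) /
      (a z ^ 2 + b z ^ 2 + 1 / ((n : ℝ) + 1)) ^ 2)) atTop (𝓝 (∫ z : P2, (0 : ℝ))) := by
    apply tendsto_integral_of_dominated_convergence (fun z => χ z * |C|)
    · intro n
      have hn : (0 : ℝ) < 1 / ((n : ℝ) + 1) := by positivity
      have hne2 : ∀ z, (a z ^ 2 + b z ^ 2 + 1 / ((n : ℝ) + 1)) ^ 2 ≠ 0 := fun z => by positivity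
      apply Continuous.aestronglyMeasurable
      fun_prop (disch := assumption)
    · apply Continuous.integrable_of_hasCompactSupport (by fun_prop) (hcs _)
    · intro n
      refine Eventually.of_forall (fun z => ?_)
      have hn : (0 : ℝ) < 1 / ((n : ℝ) + 1) := by positivity
      set ε := 1 / ((n : ℝ) + 1)
      have := hχ0 z
      rw [Real.norm_of_nonneg (by positivity)]
      gcongr
      rw [div_le_iff₀ (by positivity)]
      have : 0 ≤ |C| := abs_nonneg C
      have e : |C| * (a z ^ 2 + b z ^ 2 + ε) ^ 2 - 2 * ε * (|C| * (a z ^ 2 + b z ^ 2)) =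
        |C| * ((a z ^ 2 + b z ^ 2) ^ 2 + ε ^ 2) := by ring
      have : 0 ≤ |C| * ((a z ^ 2 + b z ^ 2) ^ 2 + ε ^ 2) := by positivity
      linarith
    · refine Eventually.of_forall (fun z => ?_)
      by_cases hz : a z ^ 2 + b z ^ 2 = 0
      · simp [hz]
      · have t := tendsto_one_div_add_atTop_nhds_zero_nat (𝕜 := ℝ)
        have t2 := (((t.const_mul 2).mul_const (|C| * (a z ^ 2 + b z ^ 2))).div
          ((t.const_add (a z ^ 2 + b z ^ 2)).pow 2) (by simpa using hz)).const_mul (χ z)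
        simpa using t2
  have : c0 ≤ ∫ z : P2, (0 : ℝ) := by
    apply ge_of_tendsto' hlim
    intro n
    apply hle
    · positivity
    · rw [div_le_one (by positivity)]; linarith [(Nat.cast_nonneg n : (0 : ℝ) ≤ n)]
  simp at this
  linarith
end BP

namespace BP
open MeasureTheory Filter Topology

lemma pd_inner {X Y : P2 → E3} (hX : Sm X) (hY : Sm Y) (v z : P2) :
    pd v (fun z => ⟪X z, Y z⟫) z = ⟪pd v X z, Y z⟫ + ⟪X z, pd v Y z⟫ := by
  unfold pd
  rw [fderiv_inner_apply ℝ (hX.da z) (hY.da z)]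
  ring

lemma inner3 (u v : E3) : ⟪u, v⟫ = u 0 * v 0 + u 1 * v 1 + u 2 * v 2 := by
  simp [PiLp.inner_apply, Fin.sum_univ_three, mul_comm]

lemma ortho_zero {X Y n u : E3} (hn : ⟪n, n⟫ = 1) (hX : ⟪n, X⟫ = 0) (hY : ⟪n, Y⟫ = 0)
    (hD : ⟪X, X⟫ * ⟪Y, Y⟫ - ⟪X, Y⟫ ^ 2 ≠ 0) (uX : ⟪u, X⟫ = 0) (uY : ⟪u, Y⟫ = 0)
    (un : ⟪u, n⟫ = 0) : u = 0 := by
  let M : Matrix (Fin 3) (Fin 3) ℝ := !![X 0, X 1, X 2; Y 0, Y 1, Y 2; n 0, n 1, n 2]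
  have hdet : M.det ^ 2 = ⟪X, X⟫ * ⟪Y, Y⟫ - ⟪X, Y⟫ ^ 2 := by
    have h1 : ⟪X, X⟫ * ⟪Y, Y⟫ - ⟪X, Y⟫ ^ 2 = (⟪X, X⟫ * ⟪Y, Y⟫ - ⟪X, Y⟫ ^ 2) * ⟪n, n⟫
      - ⟪X, X⟫ * ⟪n, Y⟫ ^ 2 - ⟪Y, Y⟫ * ⟪n, X⟫ ^ 2 + 2 * ⟪X, Y⟫ * ⟪n, X⟫ * ⟪n, Y⟫ := by
      rw [hn, hX, hY]; ring
    rw [h1]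
    simp only [M, Matrix.det_fin_three, inner3]
    simp
    ring
  have hM : M.det ≠ 0 := by
    intro h; rw [h] at hdet; apply hD; rw [← hdet]; ring
  have : M.mulVec (fun i => u i) = 0 := by
    rw [inner3] at uX uY un
    ext i
    fin_cases i <;> simp [M, Matrix.mulVec, dotProduct, Fin.sum_univ_three] <;> linarith
  have h0 := Matrix.eq_zero_of_mulVec_eq_zero hM this
  ext i
  exact congrFun h0 i

lemma tangent_inner {X Y n u : E3} (w : E3) (hn : ⟪n, n⟫ = 1) (hX : ⟪n, X⟫ = 0) (hY : ⟪n, Y⟫ = 0)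
    (hD : ⟪X, X⟫ * ⟪Y, Y⟫ - ⟪X, Y⟫ ^ 2 ≠ 0) (un : ⟪u, n⟫ = 0) :
    (⟪X, X⟫ * ⟪Y, Y⟫ - ⟪X, Y⟫ ^ 2) * ⟪u, w⟫ = ⟪Y, Y⟫ * (⟪u, X⟫ * ⟪X, w⟫)
      - ⟪X, Y⟫ * (⟪u, X⟫ * ⟪Y, w⟫ + ⟪u, Y⟫ * ⟪X, w⟫) + ⟪X, X⟫ * (⟪u, Y⟫ * ⟪Y, w⟫) := by
  have h : (⟪X, X⟫ * ⟪Y, Y⟫ - ⟪X, Y⟫ ^ 2) • u - ((⟪Y, Y⟫ * ⟪u, X⟫ - ⟪X, Y⟫ * ⟪u, Y⟫) • X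
      + (⟪X, X⟫ * ⟪u, Y⟫ - ⟪X, Y⟫ * ⟪u, X⟫) • Y) = 0 := by
    apply ortho_zero hn hX hY hD
    · simp only [inner_sub_left, inner_add_left, real_inner_smul_left]
      rw [real_inner_comm X Y]; ring
    · simp only [inner_sub_left, inner_add_left, real_inner_smul_left]
      ring
    · simp only [inner_sub_left, inner_add_left, real_inner_smul_left]
      rw [real_inner_comm n X, real_inner_comm n Y, hX, hY, un]; ring
  have h2 := congrArg (fun t => ⟪t, w⟫) h
  simp only [inner_sub_left, inner_add_left, real_inner_smul_left, inner_zero_left] at h2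
  linarith

/-- A parametrized surface with unit normal. -/
structure Surf (f n : P2 → E3) : Prop where
  hf : Sm f
  hn : Sm n
  n1 : ∀ z, ⟪n z, n z⟫ = 1
  nf1 : ∀ z, ⟪n z, pd e1 f z⟫ = 0
  nf2 : ∀ z, ⟪n z, pd e2 f z⟫ = 0
  hD : ∀ z, 0 < ⟪pd e1 f z, pd e1 f z⟫ * ⟪pd e2 f z, pd e2 f z⟫ - ⟪pd e1 f z, pd e2 f z⟫ ^ 2

def gg (f : P2 → E3) (v w z : P2) : ℝ := ⟪pd v f z, pd w f z⟫
def AA (f n : P2 → E3) (v w z : P2) : ℝ := ⟪n z, pd w (pd v f) z⟫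
def TT (f : P2 → E3) (u v w z : P2) : ℝ := ⟪pd u f z, pd w (pd v f) z⟫

lemma Sm.inner {X Y : P2 → E3} (hX : Sm X) (hY : Sm Y) : Sm (fun z => ⟪X z, Y z⟫) :=
  ContDiff.inner ℝ hX hY

lemma gg_sm {f : P2 → E3} (h : Sm f) (v w : P2) : Sm (gg f v w) := (h.pd v).inner (h.pd w)
lemma AA_sm {f n : P2 → E3} (h : Sm f) (hn : Sm n) (v w : P2) : Sm (AA f n v w) :=
  hn.inner ((h.pd v).pd w)
lemma TT_sm {f : P2 → E3} (h : Sm f) (u v w : P2) : Sm (TT f u v w) :=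
  (h.pd u).inner ((h.pd v).pd w)

lemma AA_comm {f n : P2 → E3} (h : Sm f) (v w : P2) : AA f n v w = AA f n w v := by
  ext z; unfold AA; rw [pd_comm h]

lemma koszul {f : P2 → E3} (h : Sm f) (u v w z : P2) :
    2 * TT f u v w z = pd v (gg f u w) z + pd w (gg f u v) z - pd u (gg f v w) z := by
  have e : ∀ a b c, pd a (gg f b c) z = TT f c b a z + TT f b c a z := by
    intro a b c
    have : pd a (gg f b c) z = _ := pd_inner (h.pd b) (h.pd c) a z
    rw [this]; unfold TT
    rw [real_inner_comm]
  have s : ∀ a b c, TT f a b c z = TT f a c b z := by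
    intro a b c; unfold TT; rw [pd_comm h]
  rw [e, e, e, s w u v, s w v u, s v u w, s u w v]; ring

namespace Surf
variable {f n : P2 → E3}

lemma dn_n (S : Surf f n) (v z : P2) : ⟪pd v n z, n z⟫ = 0 := by
  have h := pd_inner S.hn S.hn v z
  have : (fun z => ⟪n z, n z⟫) = fun _ => (1 : ℝ) := funext S.n1
  rw [this, pd_const, real_inner_comm] at h
  rw [real_inner_comm]; linarith

lemma wein1 (S : Surf f n) (v z : P2) : ⟪pd v n z, pd e1 f z⟫ = - AA f n e1 v z := by
  have h := pd_inner S.hn (S.hf.pd e1) v z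
  rw [funext S.nf1, pd_const] at h
  unfold AA; linarith

lemma wein2 (S : Surf f n) (v z : P2) : ⟪pd v n z, pd e2 f z⟫ = - AA f n e2 v z := by
  have h := pd_inner S.hn (S.hf.pd e2) v z
  rw [funext S.nf2, pd_const] at h
  unfold AA; linarith

lemma dn_inner (S : Surf f n) (w u v z : P2) :
    (gg f e1 e1 z * gg f e2 e2 z - gg f e1 e2 z ^ 2) * ⟪pd w n z, pd v (pd u f) z⟫ =
    -(gg f e2 e2 z * (AA f n e1 w z * TT f e1 u v z)
      - gg f e1 e2 z * (AA f n e1 w z * TT f e2 u v z + AA f n e2 w z * TT f e1 u v z)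
      + gg f e1 e1 z * (AA f n e2 w z * TT f e2 u v z)) := by
  have := tangent_inner (pd v (pd u f) z) (S.n1 z) (S.nf1 z) (S.nf2 z) (S.hD z).ne' (S.dn_n w z)
  unfold gg TT
  rw [this, S.wein1, S.wein2]; ring

lemma codazzi (S : Surf f n) (u v w z : P2) :
    pd w (AA f n u v) z - pd v (AA f n u w) z =
      ⟪pd w n z, pd v (pd u f) z⟫ - ⟪pd v n z, pd w (pd u f) z⟫ := by
  have h1 : pd w (AA f n u v) z = _ := pd_inner S.hn ((S.hf.pd u).pd v) w z
  have h2 : pd v (AA f n u w) z = _ := pd_inner S.hn ((S.hf.pd u).pd w) v z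
  rw [h1, h2, pd_comm (S.hf.pd u) v w]; ring

end Surf

/-- Pointwise elliptic inequality. -/
lemma ell_ineq {E F G a1 b1 l1 l2 : ℝ} (hE : 0 < E) (hD : 0 < E * G - F ^ 2) :
    (2 * F * a1 * b1 - G * a1 ^ 2) / E - b1 ^ 2 + a1 * l2 - b1 * l1 ≤
      (E * (E + G) / (4 * (E * G - F ^ 2))) * (l1 ^ 2 + l2 ^ 2) := by
  have hG : 0 < G := by
    by_contra h; push Not at h; nlinarith [sq_nonneg F]
  set D := E * G - F ^ 2 with hDd
  set k := D / (E * (E + G)) with hk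
  have hkpos : 0 < k := by positivity
  have h1 : (2 * F * a1 * b1 - G * a1 ^ 2) / E - b1 ^ 2 ≤ -k * (a1 ^ 2 + b1 ^ 2) := by
    have e : -k * (a1 ^ 2 + b1 ^ 2) - ((2 * F * a1 * b1 - G * a1 ^ 2) / E - b1 ^ 2) =
      ((G * a1 - F * b1) ^ 2 + (E * b1 - F * a1) ^ 2) / (E * (E + G)) := by
      rw [hk, hDd]; field_simp; ring
    have : 0 ≤ ((G * a1 - F * b1) ^ 2 + (E * b1 - F * a1) ^ 2) / (E * (E + G)) := by positivity
    linarith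
  have h2 : E * (E + G) / (4 * D) = 1 / (4 * k) := by rw [hk]; field_simp
  rw [h2]
  have h3 : 1 / (4 * k) * (l1 ^ 2 + l2 ^ 2) - (-k * (a1 ^ 2 + b1 ^ 2) + a1 * l2 - b1 * l1) =
      ((2 * k * a1 - l2) ^ 2 + (2 * k * b1 + l1) ^ 2) / (4 * k) := by field_simp; ring
  have : 0 ≤ ((2 * k * a1 - l2) ^ 2 + (2 * k * b1 + l1) ^ 2) / (4 * k) := by positivity
  linarith

/-- Jacobian bound for the difference of second fundamental forms. -/
lemma jac_bound {f n f' n' : P2 → E3} (S : Surf f n) (S' : Surf f' n')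
    (hg : ∀ v w, gg f v w = gg f' v w)
    (htr : ∀ z, gg f e1 e1 z * (AA f n e2 e2 z - AA f' n' e2 e2 z)
      + gg f e2 e2 z * (AA f n e1 e1 z - AA f' n' e1 e1 z)
      - 2 * gg f e1 e2 z * (AA f n e1 e2 z - AA f' n' e1 e2 z) = 0) :
    ∃ C : P2 → ℝ, Continuous C ∧ ∀ z,
      pd e1 (fun z => AA f n e1 e1 z - AA f' n' e1 e1 z) z *
        pd e2 (fun z => AA f n e1 e2 z - AA f' n' e1 e2 z) z
      - pd e2 (fun z => AA f n e1 e1 z - AA f' n' e1 e1 z) z *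
        pd e1 (fun z => AA f n e1 e2 z - AA f' n' e1 e2 z) z
      ≤ C z * ((AA f n e1 e1 z - AA f' n' e1 e1 z) ^ 2 + (AA f n e1 e2 z - AA f' n' e1 e2 z) ^ 2) := by
  set E := gg f e1 e1 with hE
  set F := gg f e1 e2 with hF
  set G := gg f e2 e2 with hG
  set a : P2 → ℝ := fun z => AA f n e1 e1 z - AA f' n' e1 e1 z with ha
  set b : P2 → ℝ := fun z => AA f n e1 e2 z - AA f' n' e1 e2 z with hb
  set c : P2 → ℝ := fun z => AA f n e2 e2 z - AA f' n' e2 e2 z with hc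
  have sE : Sm E := gg_sm S.hf _ _
  have sF : Sm F := gg_sm S.hf _ _
  have sG : Sm G := gg_sm S.hf _ _
  have sa : Sm a := (AA_sm S.hf S.hn _ _).sub (AA_sm S'.hf S'.hn _ _)
  have sb : Sm b := (AA_sm S.hf S.hn _ _).sub (AA_sm S'.hf S'.hn _ _)
  have sc : Sm c := (AA_sm S.hf S.hn _ _).sub (AA_sm S'.hf S'.hn _ _)
  have hT : ∀ u v w z, TT f' u v w z = TT f u v w z := by
    intro u v w z
    have h1 := koszul S.hf u v w z
    have h2 := koszul S'.hf u v w z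
    simp only [hg] at h1
    linarith
  have hDpos : ∀ z, 0 < E z * G z - F z ^ 2 := S.hD
  have hEpos : ∀ z, 0 < E z := by
    intro z
    have h1 : 0 ≤ E z := real_inner_self_nonneg
    rcases h1.lt_or_eq with h | h
    · exact h
    · have := hDpos z; rw [← h] at this; nlinarith [sq_nonneg (F z)]
  have cod : ∀ u z, (E z * G z - F z ^ 2) * (pd e2 (fun z => AA f n u e1 z - AA f' n' u e1 z) z
      - pd e1 (fun z => AA f n u e2 z - AA f' n' u e2 z) z) =
      -(G z * (b z * TT f e1 u e1 z) - F z * (b z * TT f e2 u e1 z + c z * TT f e1 u e1 z)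
        + E z * (c z * TT f e2 u e1 z))
      + (G z * (a z * TT f e1 u e2 z) - F z * (a z * TT f e2 u e2 z + b z * TT f e1 u e2 z)
        + E z * (b z * TT f e2 u e2 z)) := by
    intro u z
    rw [pd_sub (AA_sm S.hf S.hn _ _) (AA_sm S'.hf S'.hn _ _),
      pd_sub (AA_sm S.hf S.hn _ _) (AA_sm S'.hf S'.hn _ _)]
    have k1 := S.codazzi u e1 e2 z
    have k2 := S'.codazzi u e1 e2 z
    have d1 := S.dn_inner e2 u e1 z
    have d2 := S.dn_inner e1 u e2 z
    have d3 := S'.dn_inner e2 u e1 z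
    have d4 := S'.dn_inner e1 u e2 z
    simp only [← hg, hT] at d3 d4
    rw [AA_comm S.hf e2 e1] at d2
    rw [AA_comm S'.hf e2 e1] at d4
    simp only [← hE, ← hF, ← hG] at d1 d2 d3 d4
    have : pd e2 (AA f n u e1) z - pd e2 (AA f' n' u e1) z -
        (pd e1 (AA f n u e2) z - pd e1 (AA f' n' u e2) z) =
        (⟪pd e2 n z, pd e1 (pd u f) z⟫ - ⟪pd e1 n z, pd e2 (pd u f) z⟫)
        - (⟪pd e2 n' z, pd e1 (pd u f') z⟫ - ⟪pd e1 n' z, pd e2 (pd u f') z⟫) := by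
      rw [← k1, ← k2]; ring
    rw [this]
    simp only [ha, hb, hc]
    linear_combination d1 - d2 - d3 + d4
  have cod1 := cod e1
  have cod2 := cod e2
  simp only [AA_comm S.hf e2 e1, AA_comm S'.hf e2 e1] at cod2
  change ∀ z, _ * (pd e2 a z - pd e1 b z) = _ at cod1
  change ∀ z, _ * (pd e2 b z - pd e1 c z) = _ at cod2
  have htrx : ∀ z, pd e1 E z * c z + E z * pd e1 c z + (pd e1 G z * a z + G z * pd e1 a z)
      - 2 * (pd e1 F z * b z + F z * pd e1 b z) = 0 := by
    intro z
    have h0 : (fun z => (E z * c z + G z * a z) - (F z * b z + F z * b z)) = fun _ => (0 : ℝ) := by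
      ext z; have := htr z; simp only [ha, hb, hc]; linarith
    have h1 := congrArg (fun t => pd e1 t z) h0
    simp only [pd_const] at h1
    rw [pd_sub ((sE.mul sc).add (sG.mul sa)) ((sF.mul sb).add (sF.mul sb)),
      pd_add (sE.mul sc) (sG.mul sa), pd_add (sF.mul sb) (sF.mul sb), pd_mul sE sc, pd_mul sG sa,
      pd_mul sF sb] at h1
    linarith
  -- coefficients
  set D : P2 → ℝ := fun z => E z * G z - F z ^ 2 with hD
  have key : ∃ l1a l1b l2a l2b : P2 → ℝ, Continuous l1a ∧ Continuous l1b ∧ Continuous l2a ∧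
      Continuous l2b ∧ ∀ z, pd e2 a z = pd e1 b z + (l1a z * a z + l1b z * b z) ∧
        pd e2 b z = (2 * F z * pd e1 b z - G z * pd e1 a z) / E z + (l2a z * a z + l2b z * b z) := by
    have cE := sE.continuous
    have cF := sF.continuous
    have cG := sG.continuous
    have cE1 := (sE.pd e1).continuous
    have cF1 := (sF.pd e1).continuous
    have cG1 := (sG.pd e1).continuous
    have cT : ∀ u v w, Continuous (TT f u v w) := fun u v w => (TT_sm S.hf u v w).continuous
    have hE0 : ∀ z, E z ≠ 0 := fun z => (hEpos z).ne'
    have hD0 : ∀ z, D z ≠ 0 := fun z => (hDpos z).ne'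
    have cD : Continuous D := by fun_prop
    have hcz : ∀ z, c z = (2 * F z * b z - G z * a z) / E z := by
      intro z
      rw [eq_div_iff (hE0 z)]
      have := htr z; simp only [ha, hb, hc]; linarith
    refine ⟨fun z => ((-(-F z * TT f e1 e1 e1 z + E z * TT f e2 e1 e1 z)) * (-G z / E z)
        + (G z * TT f e1 e1 e2 z - F z * TT f e2 e1 e2 z)) / D z,
      fun z => ((-(-F z * TT f e1 e1 e1 z + E z * TT f e2 e1 e1 z)) * (2 * F z / E z)
        - (G z * TT f e1 e1 e1 z - F z * TT f e2 e1 e1 z)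
        + (- F z * TT f e1 e1 e2 z + E z * TT f e2 e1 e2 z)) / D z,
      fun z => ((-(-F z * TT f e1 e2 e1 z + E z * TT f e2 e2 e1 z)) * (-G z / E z)
        + (G z * TT f e1 e2 e2 z - F z * TT f e2 e2 e2 z)) / D z
        + (- pd e1 E z * (-G z / E z) - pd e1 G z) / E z,
      fun z => ((-(-F z * TT f e1 e2 e1 z + E z * TT f e2 e2 e1 z)) * (2 * F z / E z)
        - (G z * TT f e1 e2 e1 z - F z * TT f e2 e2 e1 z)
        + (- F z * TT f e1 e2 e2 z + E z * TT f e2 e2 e2 z)) / D z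
        + (- pd e1 E z * (2 * F z / E z) + 2 * pd e1 F z) / E z,
      by fun_prop (disch := assumption), by fun_prop (disch := assumption),
      by fun_prop (disch := assumption), by fun_prop (disch := assumption), ?_⟩
    intro z
    have t1 := cod1 z
    have t2 := cod2 z
    have t3 := htrx z
    have hDz := hD0 z
    have hEz := hE0 z
    constructor
    · have t1' : pd e2 a z - pd e1 b z = _ := eq_div_of_mul_eq hDz ((mul_comm _ _).trans t1)
      rw [sub_eq_iff_eq_add] at t1'
      rw [t1', hcz z]
      simp only [← hD]
      field_simp
      ring
    · have t2' : pd e2 b z - pd e1 c z = _ := eq_div_of_mul_eq hDz ((mul_comm _ _).trans t2)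
      rw [sub_eq_iff_eq_add] at t2'
      have t3' : pd e1 c z = (- pd e1 E z * c z - pd e1 G z * a z - G z * pd e1 a z
        + 2 * (pd e1 F z * b z + F z * pd e1 b z)) / E z := by
        rw [eq_div_iff hEz]; linarith
      rw [t2', t3', hcz z]
      field_simp
      ring
  obtain ⟨l1a, l1b, l2a, l2b, c1, c2, c3, c4, hk⟩ := key
  have cE := sE.continuous
  have cF := sF.continuous
  have cG := sG.continuous
  have hD4 : ∀ z, 4 * (E z * G z - F z ^ 2) ≠ 0 := fun z => by have := hDpos z; positivity
  refine ⟨fun z => (E z * (E z + G z) / (4 * (E z * G z - F z ^ 2))) *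
    (l1a z ^ 2 + l1b z ^ 2 + l2a z ^ 2 + l2b z ^ 2), by fun_prop (disch := assumption), ?_⟩
  intro z
  obtain ⟨k1, k2⟩ := hk z
  have hEz := hEpos z
  have hDz := hDpos z
  have hGz : 0 < G z := by
    by_contra h; push Not at h; nlinarith [sq_nonneg (F z)]
  have := ell_ineq (a1 := pd e1 a z) (b1 := pd e1 b z) (l1 := l1a z * a z + l1b z * b z)
    (l2 := l2a z * a z + l2b z * b z) hEz hDz
  calc _ = (2 * F z * pd e1 a z * pd e1 b z - G z * pd e1 a z ^ 2) / E z - pd e1 b z ^ 2 +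
        pd e1 a z * (l2a z * a z + l2b z * b z) - pd e1 b z * (l1a z * a z + l1b z * b z) := by
        rw [k1, k2]; field_simp; ring
    _ ≤ _ := this
    _ ≤ _ := by
        show _ ≤ (E z * (E z + G z) / (4 * (E z * G z - F z ^ 2))) *
          (l1a z ^ 2 + l1b z ^ 2 + l2a z ^ 2 + l2b z ^ 2) * (a z ^ 2 + b z ^ 2)
        rw [mul_assoc]
        gcongr
        nlinarith [sq_nonneg (l1a z * b z - l1b z * a z), sq_nonneg (l2a z * b z - l2b z * a z)]
end BP

namespace BP
open MeasureTheory Filter Topology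

lemma pd_smul_const {φ : P2 → ℝ} (h : Sm φ) (a : E3) (v z : P2) :
    pd v (fun z => φ z • a) z = pd v φ z • a := by
  unfold pd; rw [fderiv_smul_const (h.da z)]; rfl

lemma pd_fst (v z : P2) : pd v (fun z : P2 => z.1) z = v.1 := by
  unfold pd; exact congrArg (fun L : P2 →L[ℝ] ℝ => L v) (fderiv_fst (𝕜 := ℝ) (p := z))
lemma pd_snd (v z : P2) : pd v (fun z : P2 => z.2) z = v.2 := by
  unfold pd; exact congrArg (fun L : P2 →L[ℝ] ℝ => L v) (fderiv_snd (𝕜 := ℝ) (p := z))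

/-- Conformal chart of the sphere. -/
structure Chart (s : P2 → E3) : Prop where
  hs : Sm s
  s1 : ∀ z, ⟪s z, s z⟫ = 1
  s12 : ∀ z, ⟪pd e1 s z, pd e2 s z⟫ = 0
  s11 : ∀ z, 0 < ⟪pd e1 s z, pd e1 s z⟫
  s22 : ∀ z, ⟪pd e2 s z, pd e2 s z⟫ = ⟪pd e1 s z, pd e1 s z⟫

/-- Stereographic chart. -/
def stereo (a b p : E3) (z : P2) : E3 :=
  (2 * z.1 * (1 + z.1 ^ 2 + z.2 ^ 2)⁻¹) • a + (2 * z.2 * (1 + z.1 ^ 2 + z.2 ^ 2)⁻¹) • b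
    + (1 - 2 * (1 + z.1 ^ 2 + z.2 ^ 2)⁻¹) • p

/-- Orthonormal triple. -/
structure ON (a b p : E3) : Prop where
  aa : ⟪a, a⟫ = 1
  bb : ⟪b, b⟫ = 1
  pp : ⟪p, p⟫ = 1
  ab : ⟪a, b⟫ = 0
  ap : ⟪a, p⟫ = 0
  bp : ⟪b, p⟫ = 0

lemma ON.neg {a b p : E3} (h : ON a b p) : ON a b (-p) := by
  constructor <;> simp only [inner_neg_left, inner_neg_right, h.aa, h.bb, h.pp, h.ab, h.ap, h.bp, neg_neg, neg_zero]

lemma ON.inner {a b p : E3} (h : ON a b p) (x y z x' y' z' : ℝ) :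
    ⟪x • a + y • b + z • p, x' • a + y' • b + z' • p⟫ = x * x' + y * y' + z * z' := by
  simp only [inner_add_left, inner_add_right, real_inner_smul_left, real_inner_smul_right]
  rw [real_inner_comm a b, real_inner_comm a p, real_inner_comm b p, h.aa, h.bb, h.pp, h.ab, h.ap, h.bp]
  ring

lemma rho_pos (z : P2) : 0 < 1 + z.1 ^ 2 + z.2 ^ 2 := by positivity

lemma rho_sm : Sm (fun z : P2 => (1 + z.1 ^ 2 + z.2 ^ 2)⁻¹) := by
  apply ContDiff.inv
  · fun_prop
  · intro z; exact (rho_pos z).ne'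

lemma pd_rho (v z : P2) : pd v (fun z : P2 => (1 + z.1 ^ 2 + z.2 ^ 2)⁻¹) z =
    -(2 * z.1 * v.1 + 2 * z.2 * v.2) * ((1 + z.1 ^ 2 + z.2 ^ 2)⁻¹) ^ 2 := by
  have hs : Sm (fun z : P2 => 1 + z.1 ^ 2 + z.2 ^ 2) := by unfold Sm; fun_prop
  rw [pd_inv hs v z (rho_pos z).ne']
  have : pd v (fun z : P2 => 1 + z.1 ^ 2 + z.2 ^ 2) z = 2 * z.1 * v.1 + 2 * z.2 * v.2 := by
    have e : (fun z : P2 => 1 + z.1 ^ 2 + z.2 ^ 2) = fun z : P2 => (1 + z.1 * z.1) + z.2 * z.2 := by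
      ext z; ring
    rw [e, pd_add (by unfold Sm; fun_prop) (by unfold Sm; fun_prop), pd_add (by unfold Sm; fun_prop) (by unfold Sm; fun_prop),
      pd_mul (by unfold Sm; fun_prop) (by unfold Sm; fun_prop), pd_mul (by unfold Sm; fun_prop) (by unfold Sm; fun_prop), pd_fst, pd_snd, pd_const]
    ring
  rw [this]; field_simp

lemma stereo_sm (a b p : E3) : Sm (stereo a b p) := by
  have h0 := rho_sm
  have c1 : Sm (fun z : P2 => 2 * z.1) := by unfold Sm; fun_prop
  have c2 : Sm (fun z : P2 => 2 * z.2) := by unfold Sm; fun_prop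
  have ck : ∀ c : ℝ, Sm (fun _ : P2 => c) := fun c => contDiff_const
  have h1 : Sm (fun z : P2 => 2 * z.1 * (1 + z.1 ^ 2 + z.2 ^ 2)⁻¹) := c1.mul h0
  have h2 : Sm (fun z : P2 => 2 * z.2 * (1 + z.1 ^ 2 + z.2 ^ 2)⁻¹) := c2.mul h0
  have h3' : Sm (fun z : P2 => 2 * (1 + z.1 ^ 2 + z.2 ^ 2)⁻¹) := (ck 2).mul h0
  have h3 : Sm (fun z : P2 => 1 - 2 * (1 + z.1 ^ 2 + z.2 ^ 2)⁻¹) := (ck 1).sub h3'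
  exact ((h1.smul contDiff_const).add (h2.smul contDiff_const)).add (h3.smul contDiff_const)

lemma pd_stereo (a b p : E3) (v z : P2) : pd v (stereo a b p) z =
    (2 * v.1 * (1 + z.1 ^ 2 + z.2 ^ 2)⁻¹ - 2 * z.1 * ((2 * z.1 * v.1 + 2 * z.2 * v.2) * ((1 + z.1 ^ 2 + z.2 ^ 2)⁻¹) ^ 2)) • a
    + (2 * v.2 * (1 + z.1 ^ 2 + z.2 ^ 2)⁻¹ - 2 * z.2 * ((2 * z.1 * v.1 + 2 * z.2 * v.2) * ((1 + z.1 ^ 2 + z.2 ^ 2)⁻¹) ^ 2)) • b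
    + (2 * ((2 * z.1 * v.1 + 2 * z.2 * v.2) * ((1 + z.1 ^ 2 + z.2 ^ 2)⁻¹) ^ 2)) • p := by
  have h0 := rho_sm
  have c1 : Sm (fun z : P2 => 2 * z.1) := by unfold Sm; fun_prop
  have c2 : Sm (fun z : P2 => 2 * z.2) := by unfold Sm; fun_prop
  have ck : ∀ c : ℝ, Sm (fun z : P2 => c) := fun c => contDiff_const
  have h1 : Sm (fun z : P2 => 2 * z.1 * (1 + z.1 ^ 2 + z.2 ^ 2)⁻¹) := c1.mul h0
  have h2 : Sm (fun z : P2 => 2 * z.2 * (1 + z.1 ^ 2 + z.2 ^ 2)⁻¹) := c2.mul h0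
  have h3' : Sm (fun z : P2 => 2 * (1 + z.1 ^ 2 + z.2 ^ 2)⁻¹) := (ck 2).mul h0
  have h3 : Sm (fun z : P2 => 1 - 2 * (1 + z.1 ^ 2 + z.2 ^ 2)⁻¹) := (ck 1).sub h3'
  have d1 : pd v (fun z : P2 => 2 * z.1) z = 2 * v.1 := by
    rw [pd_mul (ck 2) (by unfold Sm; fun_prop), pd_const, pd_fst]; ring
  have d2 : pd v (fun z : P2 => 2 * z.2) z = 2 * v.2 := by
    rw [pd_mul (ck 2) (by unfold Sm; fun_prop), pd_const, pd_snd]; ring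
  have es : stereo a b p = fun z => ((2 * z.1 * (1 + z.1 ^ 2 + z.2 ^ 2)⁻¹) • a + (2 * z.2 * (1 + z.1 ^ 2 + z.2 ^ 2)⁻¹) • b)
    + (1 - 2 * (1 + z.1 ^ 2 + z.2 ^ 2)⁻¹) • p := rfl
  have s1 : Sm (fun z : P2 => (2 * z.1 * (1 + z.1 ^ 2 + z.2 ^ 2)⁻¹) • a) := h1.smul contDiff_const
  have s2 : Sm (fun z : P2 => (2 * z.2 * (1 + z.1 ^ 2 + z.2 ^ 2)⁻¹) • b) := h2.smul contDiff_const
  have s3 : Sm (fun z : P2 => (1 - 2 * (1 + z.1 ^ 2 + z.2 ^ 2)⁻¹) • p) := h3.smul contDiff_const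
  rw [es, pd_add (s1.add s2) s3, pd_add s1 s2, pd_smul_const h1, pd_smul_const h2, pd_smul_const h3,
    pd_mul c1 h0, pd_mul c2 h0, pd_sub (ck 1) h3', pd_mul (ck 2) h0, pd_rho, d1, d2, pd_const, pd_const]
  congr 2
  · congr 1; ring
  · congr 1; ring
  · ring

lemma stereo_chart {a b p : E3} (h : ON a b p) : Chart (stereo a b p) where
  hs := stereo_sm a b p
  s1 z := by
    unfold stereo; rw [h.inner]
    have := (rho_pos z).ne'
    field_simp; ring
  s12 z := by
    rw [pd_stereo, pd_stereo, h.inner]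
    have := (rho_pos z).ne'
    simp only [e1, e2]
    field_simp; ring
  s11 z := by
    rw [pd_stereo, h.inner]
    have h1 := rho_pos z
    have : ∀ r : ℝ, r = 4 / (1 + z.1 ^ 2 + z.2 ^ 2) ^ 2 → 0 < r := by
      intro r hr; rw [hr]; positivity
    apply this
    simp only [e1]
    field_simp; ring
  s22 z := by
    rw [pd_stereo, pd_stereo, h.inner, h.inner]
    have := (rho_pos z).ne'
    simp only [e1, e2]
    field_simp; ring

namespace Chart
variable {s : P2 → E3}

lemma mem (c : Chart s) (z : P2) : s z ∈ S2 := by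
  have h := c.s1 z
  rw [real_inner_self_eq_norm_sq] at h
  simp only [S2, mem_sphere_iff_norm, sub_zero]
  nlinarith [norm_nonneg (s z)]

lemma tang (c : Chart s) (v z : P2) : ⟪s z, pd v s z⟫ = 0 := by
  have h := pd_inner c.hs c.hs v z
  rw [funext c.s1, pd_const, real_inner_comm] at h
  linarith

lemma second (c : Chart s) (v w z : P2) : ⟪s z, pd w (pd v s) z⟫ = - ⟪pd v s z, pd w s z⟫ := by
  have h := pd_inner c.hs (c.hs.pd v) w z
  rw [funext (c.tang v), pd_const, real_inner_comm] at h
  linarith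

end Chart

lemma pd_comp {F : E3 → E3} {s : P2 → E3} (hF : ContDiff ℝ (⊤ : ℕ∞) F) (hs : Sm s) (v z : P2) :
    pd v (fun z => F (s z)) z = dF F (s z) (pd v s z) := by
  unfold pd dF
  have : fderiv ℝ (fun z => F (s z)) z = _ :=
    fderiv_comp z (hF.differentiable (by simp) (s z)) (hs.da z)
  rw [this]; rfl

lemma pd_comp2 {F : E3 → E3} {s : P2 → E3} (hF : ContDiff ℝ (⊤ : ℕ∞) F) (hs : Sm s) (v w z : P2) :
    pd w (pd v (fun z => F (s z))) z =
      fderiv ℝ (fun y => fderiv ℝ F y (pd v s z)) (s z) (pd w s z) + dF F (s z) (pd w (pd v s) z) := by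
  have e : pd v (fun z => F (s z)) = fun z => dF F (s z) (pd v s z) := funext (pd_comp hF hs v)
  rw [e]
  have hdF : ContDiff ℝ (⊤ : ℕ∞) (fderiv ℝ F) := hF.fderiv_right (by simp)
  have hd : DifferentiableAt ℝ (fderiv ℝ F) (s z) := hdF.differentiable (by simp) (s z)
  have hc : HasFDerivAt (fun z => fderiv ℝ F (s z)) ((fderiv ℝ (fderiv ℝ F) (s z)).comp (fderiv ℝ s z)) z :=
    hd.hasFDerivAt.comp z (hs.da z).hasFDerivAt
  have h1 := hc.clm_apply ((hs.pd v).da z).hasFDerivAt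
  have h2 := h1.fderiv
  rw [fderiv_clm_apply hd (differentiableAt_const _)]
  unfold pd dF at *
  rw [h2]
  simp [add_comm]

end BP

namespace BP
open MeasureTheory Filter Topology

lemma sff_eq {F : E3 → E3} (hF : ContDiff ℝ (⊤ : ℕ∞) F) (x ν v w : E3) :
    sff F x ν v w = ⟪ν, fderiv ℝ (fderiv ℝ F) x w v - ⟪v, w⟫ • dF F x x⟫ := by
  have hdF : ContDiff ℝ (⊤ : ℕ∞) (fderiv ℝ F) := hF.fderiv_right (by simp)
  have hd : DifferentiableAt ℝ (fderiv ℝ F) x := hdF.differentiable (by simp) x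
  unfold sff
  rw [fderiv_clm_apply hd (differentiableAt_const _)]
  simp

lemma sff_bil {F : E3 → E3} (hF : ContDiff ℝ (⊤ : ℕ∞) F) (x ν u v : E3) (α β γ δ : ℝ) :
    sff F x ν (α • u + β • v) (γ • u + δ • v) = α * γ * sff F x ν u u + α * δ * sff F x ν u v
      + β * γ * sff F x ν v u + β * δ * sff F x ν v v := by
  simp only [sff_eq hF, map_add, map_smul, add_apply, smul_apply,
    inner_add_left, inner_add_right, inner_sub_right, real_inner_smul_left, real_inner_smul_right]
  ring

lemma sff_smul {F : E3 → E3} (hF : ContDiff ℝ (⊤ : ℕ∞) F) (x ν u v : E3) (α δ : ℝ) :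
    sff F x ν (α • u) (δ • v) = α * δ * sff F x ν u v := by
  have := sff_bil hF x ν u v α 0 0 δ
  simpa using this

lemma AA_eq {F : E3 → E3} {s : P2 → E3} (hF : ContDiff ℝ (⊤ : ℕ∞) F) (c : Chart s) {ν : E3} (v w z : P2)
    (hν : IsUnitNormalAt F (s z) ν) :
    ⟪ν, pd w (pd v (fun z => F (s z))) z⟫ = sff F (s z) ν (pd v s z) (pd w s z) := by
  rw [pd_comp2 hF c.hs]
  have h := hν.2 (pd w (pd v s) z + ⟪pd v s z, pd w s z⟫ • s z) (by
    unfold Tang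
    rw [inner_add_right, real_inner_smul_right, c.second, c.s1]; ring)
  rw [map_add, map_smul, inner_add_right, real_inner_smul_right] at h
  unfold sff
  rw [inner_add_right, inner_sub_right, real_inner_smul_right]
  linarith

/-- cross product -/
def cr (X Y : E3) : E3 := !₂[X 1 * Y 2 - X 2 * Y 1, X 2 * Y 0 - X 0 * Y 2, X 0 * Y 1 - X 1 * Y 0]

lemma cr_X (X Y : E3) : ⟪cr X Y, X⟫ = 0 := by rw [inner3]; simp [cr]; ring
lemma cr_Y (X Y : E3) : ⟪cr X Y, Y⟫ = 0 := by rw [inner3]; simp [cr]; ring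
lemma cr_cr (X Y : E3) : ⟪cr X Y, cr X Y⟫ = ⟪X, X⟫ * ⟪Y, Y⟫ - ⟪X, Y⟫ ^ 2 := by
  simp only [inner3]; simp [cr]; ring
lemma cr_sm {X Y : P2 → E3} (hX : Sm X) (hY : Sm Y) : Sm (fun z => cr (X z) (Y z)) := by
  have a : ∀ i, Sm (fun z => X z i) := fun i => contDiff_euclidean.1 hX i
  have b : ∀ i, Sm (fun z => Y z i) := fun i => contDiff_euclidean.1 hY i
  unfold Sm
  rw [contDiff_euclidean]
  intro i
  fin_cases i
  · exact ((a 1).mul (b 2)).sub ((a 2).mul (b 1))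
  · exact ((a 2).mul (b 0)).sub ((a 0).mul (b 2))
  · exact ((a 0).mul (b 1)).sub ((a 1).mul (b 0))

lemma normal_sm {f n : P2 → E3} (hf : Sm f) (hn : Continuous n) (n1 : ∀ z, ⟪n z, n z⟫ = 1)
    (nf1 : ∀ z, ⟪n z, pd e1 f z⟫ = 0) (nf2 : ∀ z, ⟪n z, pd e2 f z⟫ = 0)
    (hD : ∀ z, 0 < ⟪pd e1 f z, pd e1 f z⟫ * ⟪pd e2 f z, pd e2 f z⟫ - ⟪pd e1 f z, pd e2 f z⟫ ^ 2) :
    Sm n := by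
  set X := pd e1 f with hX
  set Y := pd e2 f with hY
  have sX : Sm X := hf.pd e1
  have sY : Sm Y := hf.pd e2
  have sD : Sm (fun z => ⟪X z, X z⟫ * ⟪Y z, Y z⟫ - ⟪X z, Y z⟫ ^ 2) :=
    ((sX.inner sX).mul (sY.inner sY)).sub ((sX.inner sY).pow 2)
  let D : P2 → ℝ := fun z => ⟪X z, X z⟫ * ⟪Y z, Y z⟫ - ⟪X z, Y z⟫ ^ 2
  have hDp : ∀ z, 0 < D z := hD
  have sS : Sm (fun z => (√(D z))⁻¹) :=
    (sD.sqrt (fun z => (hD z).ne')).inv (fun z => (Real.sqrt_pos.2 (hD z)).ne')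
  let N : P2 → E3 := fun z => (√(D z))⁻¹ • cr (X z) (Y z)
  have sN : Sm N := sS.smul (cr_sm sX sY)
  have NN : ∀ z, ⟪N z, N z⟫ = 1 := by
    intro z
    simp only [N, real_inner_smul_left, real_inner_smul_right]
    rw [cr_cr]
    change (√(D z))⁻¹ * ((√(D z))⁻¹ * D z) = 1
    have := Real.sqrt_pos.2 (hDp z)
    have h2 := Real.mul_self_sqrt (hDp z).le
    field_simp
    nlinarith
  have key : ∀ z, n z = ⟪n z, N z⟫ • N z := by
    intro z
    rw [← sub_eq_zero]
    have NX : ⟪N z, X z⟫ = 0 := by simp only [N, real_inner_smul_left]; rw [cr_X, mul_zero]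
    have NY : ⟪N z, Y z⟫ = 0 := by simp only [N, real_inner_smul_left]; rw [cr_Y, mul_zero]
    apply ortho_zero (NN z) NX NY (hD z).ne'
    · rw [inner_sub_left, real_inner_smul_left, nf1, NX]; ring
    · rw [inner_sub_left, real_inner_smul_left, nf2, NY]; ring
    · rw [inner_sub_left, real_inner_smul_left, NN]; ring
  have hsq : ∀ z, ⟪n z, N z⟫ ^ 2 = 1 := by
    intro z
    have h : ⟪n z, n z⟫ = ⟪n z, ⟪n z, N z⟫ • N z⟫ := congrArg (fun t => ⟪n z, t⟫) (key z)
    rw [n1, inner_smul_right_eq_smul, smul_eq_mul] at h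
    rw [sq]; exact h.symm
  have hcont : Continuous (fun z => ⟪n z, N z⟫) := hn.inner sN.continuous
  have hpre : IsPreconnected (Set.univ : Set P2) := isPreconnected_univ
  have hconst := hpre.eq_one_or_eq_neg_one_of_sq_eq hcont.continuousOn (fun z _ => hsq z)
  rcases hconst with h | h
  · have : n = N := by
      ext1 z
      have h1 : ⟪n z, N z⟫ = 1 := h (Set.mem_univ z)
      rw [key z, h1, one_smul]
    rw [this]; exact sN
  · have : n = fun z => - N z := by
      ext1 z
      have h1 : ⟪n z, N z⟫ = -1 := h (Set.mem_univ z)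
      rw [key z, h1, neg_one_smul]
    rw [this]; exact sN.neg

lemma mk_surf {F ν : E3 → E3} {s : P2 → E3} (hF : IsImmersionOnSphere F) (hν : Continuous ν)
    (hN : ∀ x ∈ S2, IsUnitNormalAt F x (ν x)) (c : Chart s) :
    Surf (fun z => F (s z)) (fun z => ν (s z)) := by
  have hf : Sm (fun z => F (s z)) := hF.1.comp c.hs
  have n1 : ∀ z, ⟪ν (s z), ν (s z)⟫ = 1 := by
    intro z; rw [real_inner_self_eq_norm_sq, (hN _ (c.mem z)).1]; norm_num
  have nf : ∀ v z, ⟪ν (s z), pd v (fun z => F (s z)) z⟫ = 0 := by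
    intro v z; rw [pd_comp hF.1 c.hs]; exact (hN _ (c.mem z)).2 _ (c.tang v z)
  have hD : ∀ z, 0 < ⟪pd e1 (fun z => F (s z)) z, pd e1 (fun z => F (s z)) z⟫ *
      ⟪pd e2 (fun z => F (s z)) z, pd e2 (fun z => F (s z)) z⟫
      - ⟪pd e1 (fun z => F (s z)) z, pd e2 (fun z => F (s z)) z⟫ ^ 2 := by
    intro z
    simp only [pd_comp hF.1 c.hs]
    set L := dF F (s z)
    set u := pd e1 s z with hu
    set v := pd e2 s z with hv
    have im : ∀ w, Tang (s z) w → w ≠ 0 → 0 < ⟪L w, L w⟫ := fun w hw h0 =>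
      real_inner_self_pos.2 (hF.2 _ (c.mem z) w hw h0)
    have u0 : u ≠ 0 := by
      intro h; have := c.s11 z; rw [← hu, h, inner_zero_left] at this; exact lt_irrefl _ this
    have hE := im u (c.tang e1 z) u0
    have h2 := im (⟪L u, L u⟫ • v - ⟪L u, L v⟫ • u) (by
      unfold Tang
      rw [inner_sub_right, real_inner_smul_right, real_inner_smul_right, c.tang, c.tang]; ring) (by
      intro h
      have h3 := congrArg (fun w => ⟪w, v⟫) h
      simp only [inner_sub_left, real_inner_smul_left, inner_zero_left] at h3
      have h4 : ⟪u, v⟫ = 0 := c.s12 z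
      have h5 : 0 < ⟪v, v⟫ := by rw [hv, c.s22]; exact c.s11 z
      rw [h4, mul_zero, sub_zero] at h3
      exact (mul_pos hE h5).ne' h3)
    rw [map_sub, map_smul, map_smul] at h2
    simp only [inner_sub_left, inner_sub_right, real_inner_smul_left, real_inner_smul_right] at h2
    rw [real_inner_comm (L u) (L v)] at h2
    by_contra hneg
    push Not at hneg
    nlinarith
  exact ⟨hf, normal_sm hf (hν.comp c.hs.continuous) n1 (nf e1) (nf e2) hD, n1, nf e1, nf e2, hD⟩

lemma mean_eq {F ν : E3 → E3} {s : P2 → E3} {H : E3 → ℝ} (hF : IsImmersionOnSphere F) (hν : Continuous ν)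
    (hN : ∀ x ∈ S2, IsMeanCurvAt F x (ν x) (H x)) (c : Chart s) (z : P2) :
    let f := fun z => F (s z)
    let n := fun z => ν (s z)
    gg f e1 e1 z * AA f n e2 e2 z + gg f e2 e2 z * AA f n e1 e1 z - 2 * gg f e1 e2 z * AA f n e1 e2 z
      = H (s z) * (gg f e1 e1 z * gg f e2 e2 z - gg f e1 e2 z ^ 2) := by
  intro f n
  have S := mk_surf hF hν (fun x hx => (hN x hx).1) c
  have hD := S.hD z
  have hz := hN _ (c.mem z)
  set L := ‖pd e1 s z‖ with hL
  have hLp : 0 < L := by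
    rw [hL, norm_pos_iff]; intro h; have := c.s11 z; rw [h, inner_zero_left] at this; exact lt_irrefl _ this
  have hL2 : ‖pd e2 s z‖ = L := by
    have := c.s22 z
    rw [real_inner_self_eq_norm_sq, real_inner_self_eq_norm_sq] at this
    exact (sq_eq_sq₀ (norm_nonneg _) (norm_nonneg _)).1 this
  have h := hz.2 (L⁻¹ • pd e1 s z) (L⁻¹ • pd e2 s z) (by unfold Tang; rw [real_inner_smul_right, c.tang, mul_zero])
    (by unfold Tang; rw [real_inner_smul_right, c.tang, mul_zero])
    (by rw [real_inner_smul_right, real_inner_smul_left, c.s12]; ring)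
    (by rw [norm_smul, ← hL, norm_inv, Real.norm_of_nonneg hLp.le]; field_simp)
    (by rw [norm_smul, hL2, norm_inv, Real.norm_of_nonneg hLp.le]; field_simp)
  have eg : ∀ v w, inducedMetric F (s z) (L⁻¹ • pd v s z) (L⁻¹ • pd w s z) = L⁻¹ * L⁻¹ * gg f v w z := by
    intro v w
    unfold inducedMetric gg
    rw [pd_comp hF.1 c.hs, pd_comp hF.1 c.hs, map_smul, map_smul, real_inner_smul_left, real_inner_smul_right]
    ring
  have eA : ∀ v w, sff F (s z) (ν (s z)) (L⁻¹ • pd v s z) (L⁻¹ • pd w s z) = L⁻¹ * L⁻¹ * AA f n v w z := by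
    intro v w
    unfold AA
    rw [sff_smul hF.1, AA_eq hF.1 c v w z hz.1]
  unfold traceFormula at h
  simp only [eg, eA] at h
  have hD' : gg f e1 e1 z * gg f e2 e2 z - gg f e1 e2 z ^ 2 ≠ 0 := hD.ne'
  have hden : L⁻¹ * L⁻¹ * gg f e1 e1 z * (L⁻¹ * L⁻¹ * gg f e2 e2 z) - (L⁻¹ * L⁻¹ * gg f e1 e2 z) ^ 2
    = (L⁻¹) ^ 4 * (gg f e1 e1 z * gg f e2 e2 z - gg f e1 e2 z ^ 2) := by ring
  have hLi : (L⁻¹) ^ 4 ≠ 0 := by positivity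
  rw [hden, eq_div_iff (mul_ne_zero hLi hD')] at h
  apply mul_left_cancel₀ hLi
  linarith

end BP

namespace BP
open MeasureTheory Filter Topology

lemma phi_pos {α β k q1 q2 q3 d1 d2 d3 B ε κ : ℝ} (hk : 0 < k) (hab : α ^ 2 + β ^ 2 = k ^ 2)
    (h1 : |q1| ≤ B) (h2 : |q2| ≤ B) (h3 : |q3| ≤ B) (g1 : |d1| ≤ ε) (g2 : |d2| ≤ ε) (g3 : |d3| ≤ ε)
    (hdet : q1 * q3 - q2 ^ 2 ≤ -κ) (hsm : 8 * B * ε < 2 * κ) :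
    0 < (α ^ 2 * q1 + 2 * (α * β) * q2 + β ^ 2 * q3) *
        ((2 * α ^ 2 - 2 * β ^ 2) * (q1 - q3) + α * β * (d1 - d3) + 8 * (α * β) * q2 + (β ^ 2 - α ^ 2) * d2)
      - (α * β * (q1 - q3) + (β ^ 2 - α ^ 2) * q2) *
        (-4 * (α * β) * q1 + α ^ 2 * d1 + (4 * α ^ 2 - 4 * β ^ 2) * q2 + 2 * (α * β) * d2 + 4 * (α * β) * q3 + β ^ 2 * d3) := by
  have bd : ∀ {x y z C : ℝ}, |x| ≤ C → |y| ≤ C → |z| ≤ C →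
      |α ^ 2 * x + 2 * (α * β) * y + β ^ 2 * z| ≤ 2 * k ^ 2 * C ∧
      |α * β * (x - z) + (β ^ 2 - α ^ 2) * y| ≤ 2 * k ^ 2 * C := by
    intro x y z C hx hy hz
    have hC : 0 ≤ C := (abs_nonneg x).trans hx
    have hm : 2 * |α * β| ≤ k ^ 2 := by
      rw [← hab, abs_mul]
      nlinarith [sq_nonneg (|α| - |β|), sq_abs α, sq_abs β]
    have hd : |β ^ 2 - α ^ 2| ≤ k ^ 2 := by
      rw [abs_le]; constructor <;> nlinarith [sq_nonneg α, sq_nonneg β]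
    have a1 : |α ^ 2 * x| ≤ α ^ 2 * C := by
      rw [abs_mul, abs_of_nonneg (sq_nonneg α)]; exact mul_le_mul_of_nonneg_left hx (sq_nonneg α)
    have a3 : |β ^ 2 * z| ≤ β ^ 2 * C := by
      rw [abs_mul, abs_of_nonneg (sq_nonneg β)]; exact mul_le_mul_of_nonneg_left hz (sq_nonneg β)
    have a2 : |2 * (α * β) * y| ≤ k ^ 2 * C := by
      rw [abs_mul, abs_mul, abs_two]; exact mul_le_mul hm hy (abs_nonneg _) (by positivity)
    have a4 : |α * β * (x - z)| ≤ k ^ 2 * C := by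
      have : |x - z| ≤ 2 * C := (abs_sub x z).trans (by linarith)
      rw [abs_mul]
      have := mul_le_mul hm this (abs_nonneg _) (by positivity)
      linarith
    have a5 : |(β ^ 2 - α ^ 2) * y| ≤ k ^ 2 * C := by
      rw [abs_mul]; exact mul_le_mul hd hy (abs_nonneg _) (by positivity)
    constructor
    · have t1 := abs_add_le (α ^ 2 * x + 2 * (α * β) * y) (β ^ 2 * z)
      have t2 := abs_add_le (α ^ 2 * x) (2 * (α * β) * y)
      nlinarith
    · have t1 := abs_add_le (α * β * (x - z)) ((β ^ 2 - α ^ 2) * y)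
      linarith
  obtain ⟨bA, bB⟩ := bd h1 h2 h3
  obtain ⟨bE, bG⟩ := bd g1 g2 g3
  set a := α ^ 2 * q1 + 2 * (α * β) * q2 + β ^ 2 * q3 with ha
  set b := α * β * (q1 - q3) + (β ^ 2 - α ^ 2) * q2 with hb
  set Ea := α ^ 2 * d1 + 2 * (α * β) * d2 + β ^ 2 * d3 with hEa
  set Eb := α * β * (d1 - d3) + (β ^ 2 - α ^ 2) * d2 with hEb
  have id : a * ((2 * α ^ 2 - 2 * β ^ 2) * (q1 - q3) + α * β * (d1 - d3) + 8 * (α * β) * q2 + (β ^ 2 - α ^ 2) * d2)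
      - b * (-4 * (α * β) * q1 + α ^ 2 * d1 + (4 * α ^ 2 - 4 * β ^ 2) * q2 + 2 * (α * β) * d2 + 4 * (α * β) * q3 + β ^ 2 * d3)
      = 2 * (a ^ 2 + b ^ 2) - 2 * (α ^ 2 + β ^ 2) ^ 2 * (q1 * q3 - q2 ^ 2) + (a * Eb - b * Ea) := by
    rw [ha, hb, hEa, hEb]; ring
  rw [id, hab]
  have hB : 0 ≤ B := (abs_nonneg _).trans h1
  have hε : 0 ≤ ε := (abs_nonneg _).trans g1
  have e1 : |a * Eb| ≤ (2 * k ^ 2 * B) * (2 * k ^ 2 * ε) := by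
    rw [abs_mul]; exact mul_le_mul bA bG (abs_nonneg _) (by positivity)
  have e2 : |b * Ea| ≤ (2 * k ^ 2 * B) * (2 * k ^ 2 * ε) := by
    rw [abs_mul]; exact mul_le_mul bB bE (abs_nonneg _) (by positivity)
  have e3 := (abs_le.1 e1).1
  have e4 := (abs_le.1 e2).2
  have hk4 : 0 < k ^ 4 := by positivity
  have f1 : k ^ 4 * (8 * B * ε) < k ^ 4 * (2 * κ) := mul_lt_mul_of_pos_left hsm hk4
  have f2 : k ^ 4 * (q1 * q3 - q2 ^ 2) ≤ k ^ 4 * (-κ) := mul_le_mul_of_nonneg_left hdet hk4.le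
  nlinarith [sq_nonneg a, sq_nonneg b]

lemma rot_deriv {a : P2 → ℝ} (ha : Sm a) (z : P2) (k : ℝ) :
    HasDerivAt (fun t : ℝ => a (k * (z.1 * Real.cos t - z.2 * Real.sin t), k * (z.1 * Real.sin t + z.2 * Real.cos t)))
      (pd (k * (-z.2), k * z.1) a (k * z.1, k * z.2)) 0 := by
  have c1 : HasDerivAt (fun t : ℝ => k * (z.1 * Real.cos t - z.2 * Real.sin t)) (k * (-z.2)) 0 := by
    have := (((Real.hasDerivAt_cos 0).const_mul z.1).sub ((Real.hasDerivAt_sin 0).const_mul z.2)).const_mul k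
    simpa using this
  have c2 : HasDerivAt (fun t : ℝ => k * (z.1 * Real.sin t + z.2 * Real.cos t)) (k * z.1) 0 := by
    have := (((Real.hasDerivAt_sin 0).const_mul z.1).add ((Real.hasDerivAt_cos 0).const_mul z.2)).const_mul k
    simpa using this
  have h := (ha.da (k * z.1, k * z.2)).hasFDerivAt
  have e : (k * z.1, k * z.2) = ((fun t : ℝ => (k * (z.1 * Real.cos t - z.2 * Real.sin t), k * (z.1 * Real.sin t + z.2 * Real.cos t))) 0 : P2) := by
    simp
  unfold pd
  rw [e] at h ⊢
  exact h.comp_hasDerivAt (0 : ℝ) (c1.prodMk c2)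

lemma pd_rot (a : P2 → ℝ) (z : P2) : pd (-z.2, z.1) a z = z.1 * pd e2 a z - z.2 * pd e1 a z := by
  unfold pd
  have : ((-z.2, z.1) : P2) = z.1 • e2 - z.2 • e1 := by
    simp [e1, e2]
  rw [this, map_sub, map_smul, map_smul]; rfl

lemma asym {a b q1 q2 q3 : P2 → ℝ} (ha : Sm a) (hb : Sm b) (h1 : Sm q1) (h2 : Sm q2) (h3 : Sm q3)
    (fa : ∀ z : P2, ∀ k α β : ℝ, z ≠ 0 → k = (z.1 ^ 2 + z.2 ^ 2)⁻¹ → α = k ^ 2 * (z.2 ^ 2 - z.1 ^ 2) →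
      β = k ^ 2 * (-2 * (z.1 * z.2)) →
      a z = α ^ 2 * q1 (k * z.1, k * z.2) + 2 * (α * β) * q2 (k * z.1, k * z.2) + β ^ 2 * q3 (k * z.1, k * z.2))
    (fb : ∀ z : P2, ∀ k α β : ℝ, z ≠ 0 → k = (z.1 ^ 2 + z.2 ^ 2)⁻¹ → α = k ^ 2 * (z.2 ^ 2 - z.1 ^ 2) →
      β = k ^ 2 * (-2 * (z.1 * z.2)) →
      b z = α * β * (q1 (k * z.1, k * z.2) - q3 (k * z.1, k * z.2)) + (β ^ 2 - α ^ 2) * q2 (k * z.1, k * z.2))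
    (hdet : q1 0 * q3 0 - q2 0 ^ 2 < 0) :
    ∃ R : ℝ, 0 < R ∧ ∀ z : P2, R ≤ z.1 ^ 2 + z.2 ^ 2 →
      0 < a z * (z.1 * pd e2 b z - z.2 * pd e1 b z) - b z * (z.1 * pd e2 a z - z.2 * pd e1 a z) := by
  set κ := -(q1 0 * q3 0 - q2 0 ^ 2) / 2 with hκ
  have κpos : 0 < κ := by rw [hκ]; linarith
  obtain ⟨B, hB0, hB⟩ : ∃ B : ℝ, 0 < B ∧ ∀ᶠ w in 𝓝 (0 : P2), |q1 w| ≤ B ∧ |q2 w| ≤ B ∧ |q3 w| ≤ B := by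
    refine ⟨max (max |q1 0| |q2 0|) |q3 0| + 1, by positivity, ?_⟩
    have c : ∀ q : P2 → ℝ, Sm q → |q 0| ≤ max (max |q1 0| |q2 0|) |q3 0| →
        ∀ᶠ w in 𝓝 (0 : P2), |q w| ≤ max (max |q1 0| |q2 0|) |q3 0| + 1 := by
      intro q hq hle
      have : ContinuousAt (fun w => |q w|) 0 := (hq.continuous.abs).continuousAt
      exact (this.eventually_lt continuousAt_const (by linarith)).mono (fun w h => h.le)
    filter_upwards [c q1 h1 ((le_max_left _ _).trans (le_max_left _ _)),
      c q2 h2 ((le_max_right _ _).trans (le_max_left _ _)), c q3 h3 (le_max_right _ _)] with w x y t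
    exact ⟨x, y, t⟩
  obtain ⟨M, hM0, hM⟩ : ∃ M : ℝ, 0 < M ∧ ∀ᶠ w in 𝓝 (0 : P2), ‖fderiv ℝ q1 w‖ ≤ M ∧ ‖fderiv ℝ q2 w‖ ≤ M ∧ ‖fderiv ℝ q3 w‖ ≤ M := by
    refine ⟨max (max ‖fderiv ℝ q1 0‖ ‖fderiv ℝ q2 0‖) ‖fderiv ℝ q3 0‖ + 1, by positivity, ?_⟩
    have c : ∀ q : P2 → ℝ, Sm q → ‖fderiv ℝ q 0‖ ≤ max (max ‖fderiv ℝ q1 0‖ ‖fderiv ℝ q2 0‖) ‖fderiv ℝ q3 0‖ →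
        ∀ᶠ w in 𝓝 (0 : P2), ‖fderiv ℝ q w‖ ≤ max (max ‖fderiv ℝ q1 0‖ ‖fderiv ℝ q2 0‖) ‖fderiv ℝ q3 0‖ + 1 := by
      intro q hq hle
      have : ContinuousAt (fun w => ‖fderiv ℝ q w‖) 0 := ((hq.continuous_fderiv (by simp)).norm).continuousAt
      exact (this.eventually_lt continuousAt_const (by linarith)).mono (fun w h => h.le)
    filter_upwards [c q1 h1 ((le_max_left _ _).trans (le_max_left _ _)),
      c q2 h2 ((le_max_right _ _).trans (le_max_left _ _)), c q3 h3 (le_max_right _ _)] with w x y t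
    exact ⟨x, y, t⟩
  have hd : ∀ᶠ w in 𝓝 (0 : P2), q1 w * q3 w - q2 w ^ 2 < -κ := by
    have : ContinuousAt (fun w => q1 w * q3 w - q2 w ^ 2) 0 :=
      ((h1.continuous.mul h3.continuous).sub (h2.continuous.pow 2)).continuousAt
    exact this.eventually_lt continuousAt_const (by rw [hκ]; linarith)
  have hs : ∀ᶠ w in 𝓝 (0 : P2), 8 * B * (M * ‖w‖) < 2 * κ := by
    have : ContinuousAt (fun w : P2 => 8 * B * (M * ‖w‖)) 0 := by fun_prop
    exact this.eventually_lt continuousAt_const (by simp; exact κpos)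
  obtain ⟨δ, hδ, hall⟩ := Metric.eventually_nhds_iff.1 (hB.and (hM.and (hd.and hs)))
  refine ⟨2 / δ ^ 2, by positivity, ?_⟩
  intro z hz
  set r := z.1 ^ 2 + z.2 ^ 2 with hr
  have hrpos : 0 < r := lt_of_lt_of_le (by positivity) hz
  set k := r⁻¹ with hk
  have hkpos : 0 < k := inv_pos.2 hrpos
  have hkr : k * r = 1 := inv_mul_cancel₀ hrpos.ne'
  set w : P2 := (k * z.1, k * z.2) with hw
  have hkδ : k < δ ^ 2 := by
    rw [hk, inv_lt_comm₀ hrpos (by positivity)]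
    refine lt_of_lt_of_le ?_ hz
    rw [inv_eq_one_div]
    apply div_lt_div_of_pos_right (by norm_num) (by positivity)
  have hwd : dist w 0 < δ := by
    rw [dist_zero_right, hw, Prod.norm_def, max_lt_iff]
    have e : (k * z.1) ^ 2 + (k * z.2) ^ 2 = k := by
      have : (k * z.1) ^ 2 + (k * z.2) ^ 2 = k * (k * r) := by rw [hr]; ring
      rw [this, hkr, mul_one]
    constructor
    · exact abs_lt_of_sq_lt_sq (by nlinarith [sq_nonneg (k * z.2)]) hδ.le
    · exact abs_lt_of_sq_lt_sq (by nlinarith [sq_nonneg (k * z.1)]) hδ.le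
  obtain ⟨⟨b1, b2, b3⟩, ⟨m1, m2, m3⟩, hdw, hsw⟩ := hall hwd
  have hnv : ‖((k * (-z.2), k * z.1) : P2)‖ = ‖w‖ := by
    rw [hw, Prod.norm_def, Prod.norm_def, max_comm]; simp
  have dd : ∀ q : P2 → ℝ, ‖fderiv ℝ q w‖ ≤ M → |pd (k * (-z.2), k * z.1) q w| ≤ M * ‖w‖ := by
    intro q hq
    have := (fderiv ℝ q w).le_opNorm (k * (-z.2), k * z.1)
    rw [hnv] at this
    exact this.trans (mul_le_mul_of_nonneg_right hq (norm_nonneg _))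
  set α := k ^ 2 * (z.2 ^ 2 - z.1 ^ 2) with hα
  set β := k ^ 2 * (-2 * (z.1 * z.2)) with hβ
  have hab : α ^ 2 + β ^ 2 = k ^ 2 := by
    have : α ^ 2 + β ^ 2 = k ^ 2 * (k * r) ^ 2 := by rw [hα, hβ, hr]; ring
    rw [this, hkr]; ring
  have hz0 : z ≠ 0 := by
    rintro rfl; simp [hr] at hrpos
  -- derivatives along the rotation
  let X : ℝ → ℝ := fun t => z.1 * Real.cos t - z.2 * Real.sin t
  let Y : ℝ → ℝ := fun t => z.1 * Real.sin t + z.2 * Real.cos t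
  have hX : HasDerivAt X (-z.2) 0 := by
    have := ((Real.hasDerivAt_cos 0).const_mul z.1).sub ((Real.hasDerivAt_sin 0).const_mul z.2)
    exact this.congr_deriv (by simp)
  have hY : HasDerivAt Y (z.1) 0 := by
    have := ((Real.hasDerivAt_sin 0).const_mul z.1).add ((Real.hasDerivAt_cos 0).const_mul z.2)
    exact this.congr_deriv (by simp)
  have X0 : X 0 = z.1 := by simp [X]
  have Y0 : Y 0 = z.2 := by simp [Y]
  have hXY : ∀ t, X t ^ 2 + Y t ^ 2 = r := by
    intro t
    have : X t ^ 2 + Y t ^ 2 = (z.1 ^ 2 + z.2 ^ 2) * (Real.sin t ^ 2 + Real.cos t ^ 2) := by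
      simp only [X, Y]; ring
    rw [this, Real.sin_sq_add_cos_sq, mul_one]
  have hXY0 : ∀ t, ((X t, Y t) : P2) ≠ 0 := by
    intro t h
    have h1 := hXY t
    have h2 : X t = 0 := congrArg Prod.fst h
    have h3 : Y t = 0 := congrArg Prod.snd h
    rw [h2, h3] at h1; simp at h1; exact hrpos.ne h1
  let αt : ℝ → ℝ := fun t => k ^ 2 * (Y t ^ 2 - X t ^ 2)
  let βt : ℝ → ℝ := fun t => k ^ 2 * (-2 * (X t * Y t))
  have α0 : αt 0 = α := by simp only [αt, X0, Y0, hα]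
  have β0 : βt 0 = β := by simp only [βt, X0, Y0, hβ]
  have hαt : HasDerivAt αt (-2 * β) 0 := by
    have := ((hY.pow 2).sub (hX.pow 2)).const_mul (k ^ 2)
    refine this.congr_deriv ?_
    rw [X0, Y0, hβ]; push_cast; ring
  have hβt : HasDerivAt βt (2 * α) 0 := by
    have := ((hX.mul hY).const_mul (-2)).const_mul (k ^ 2)
    refine this.congr_deriv ?_
    rw [X0, Y0, hα]; ring
  have w0 : ((k * X 0, k * Y 0) : P2) = w := by rw [X0, Y0]
  have dq : ∀ q : P2 → ℝ, Sm q → HasDerivAt (fun t => q (k * X t, k * Y t)) (pd (k * (-z.2), k * z.1) q w) 0 :=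
    fun q hq => rot_deriv hq z k
  have dp : ∀ q : P2 → ℝ, Sm q → HasDerivAt (fun t => q (X t, Y t)) (z.1 * pd e2 q z - z.2 * pd e1 q z) 0 := by
    intro q hq
    have := rot_deriv hq z 1
    simp only [one_mul] at this
    rw [pd_rot] at this
    exact this
  have ea : (fun t => a (X t, Y t)) = fun t => αt t ^ 2 * q1 (k * X t, k * Y t)
      + 2 * (αt t * βt t) * q2 (k * X t, k * Y t) + βt t ^ 2 * q3 (k * X t, k * Y t) := by
    ext t
    exact fa (X t, Y t) k _ _ (hXY0 t) (by rw [hk, ← hXY t]) rfl rfl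
  have eb : (fun t => b (X t, Y t)) = fun t => αt t * βt t * (q1 (k * X t, k * Y t) - q3 (k * X t, k * Y t))
      + (βt t ^ 2 - αt t ^ 2) * q2 (k * X t, k * Y t) := by
    ext t
    exact fb (X t, Y t) k _ _ (hXY0 t) (by rw [hk, ← hXY t]) rfl rfl
  have da := dp a ha
  have db := dp b hb
  rw [ea] at da
  rw [eb] at db
  have da' := (((hαt.pow 2).mul (dq q1 h1)).add (((hαt.mul hβt).const_mul 2).mul (dq q2 h2))).add
    ((hβt.pow 2).mul (dq q3 h3))
  have db' := ((hαt.mul hβt).mul ((dq q1 h1).sub (dq q3 h3))).add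
    (((hβt.pow 2).sub (hαt.pow 2)).mul (dq q2 h2))
  have ua := da.unique da'
  have ub := db.unique db'
  rw [ua, ub, fa z k α β hz0 rfl rfl rfl, fb z k α β hz0 rfl rfl rfl]
  have fin := phi_pos hkpos hab b1 b2 b3 (dd q1 m1) (dd q2 m2) (dd q3 m3) hdw.le hsw
  simp only [Pi.mul_apply, Pi.sub_apply, Pi.pow_apply, α0, β0, w0]
  refine lt_of_lt_of_eq fin ?_
  push_cast
  ring

end BP

namespace BP
open MeasureTheory Filter Topology

/-- The hypotheses of the theorem, bundled. -/
structure Pair (F₁ F₂ ν₁ ν₂ : E3 → E3) (H : E3 → ℝ) : Prop where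
  h1 : IsImmersionOnSphere F₁
  h2 : IsImmersionOnSphere F₂
  c1 : Continuous ν₁
  c2 : Continuous ν₂
  met : ∀ x ∈ S2, ∀ v w : E3, Tang x v → Tang x w → inducedMetric F₁ x v w = inducedMetric F₂ x v w
  m1 : ∀ x ∈ S2, IsMeanCurvAt F₁ x (ν₁ x) (H x)
  m2 : ∀ x ∈ S2, IsMeanCurvAt F₂ x (ν₂ x) (H x)

namespace Pair
variable {F₁ F₂ ν₁ ν₂ : E3 → E3} {H : E3 → ℝ} {s : P2 → E3}

lemma S1 (P : Pair F₁ F₂ ν₁ ν₂ H) (c : Chart s) : Surf (fun z => F₁ (s z)) (fun z => ν₁ (s z)) :=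
  mk_surf P.h1 P.c1 (fun x hx => (P.m1 x hx).1) c

lemma S2 (P : Pair F₁ F₂ ν₁ ν₂ H) (c : Chart s) : Surf (fun z => F₂ (s z)) (fun z => ν₂ (s z)) :=
  mk_surf P.h2 P.c2 (fun x hx => (P.m2 x hx).1) c

lemma hg (P : Pair F₁ F₂ ν₁ ν₂ H) (c : Chart s) (v w : P2) :
    gg (fun z => F₁ (s z)) v w = gg (fun z => F₂ (s z)) v w := by
  ext z
  unfold gg
  rw [pd_comp P.h1.1 c.hs, pd_comp P.h1.1 c.hs, pd_comp P.h2.1 c.hs, pd_comp P.h2.1 c.hs]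
  exact P.met _ (c.mem z) _ _ (c.tang v z) (c.tang w z)

/-- Difference of second fundamental forms in a chart. -/
def qq (F₁ F₂ ν₁ ν₂ : E3 → E3) (s : P2 → E3) (v w z : P2) : ℝ :=
  AA (fun z => F₁ (s z)) (fun z => ν₁ (s z)) v w z - AA (fun z => F₂ (s z)) (fun z => ν₂ (s z)) v w z

lemma qq_sm (P : Pair F₁ F₂ ν₁ ν₂ H) (c : Chart s) (v w : P2) : Sm (qq F₁ F₂ ν₁ ν₂ s v w) :=
  (AA_sm (P.S1 c).hf (P.S1 c).hn v w).sub (AA_sm (P.S2 c).hf (P.S2 c).hn v w)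

lemma qq_comm (P : Pair F₁ F₂ ν₁ ν₂ H) (c : Chart s) (v w z : P2) :
    qq F₁ F₂ ν₁ ν₂ s v w z = qq F₁ F₂ ν₁ ν₂ s w v z := by
  unfold qq
  rw [AA_comm (P.S1 c).hf, AA_comm (P.S2 c).hf]

lemma qq_eq (P : Pair F₁ F₂ ν₁ ν₂ H) (c : Chart s) (v w z : P2) : qq F₁ F₂ ν₁ ν₂ s v w z =
    sff F₁ (s z) (ν₁ (s z)) (pd v s z) (pd w s z) - sff F₂ (s z) (ν₂ (s z)) (pd v s z) (pd w s z) := by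
  unfold qq AA
  rw [AA_eq P.h1.1 c v w z (P.m1 _ (c.mem z)).1, AA_eq P.h2.1 c v w z (P.m2 _ (c.mem z)).1]

lemma htr (P : Pair F₁ F₂ ν₁ ν₂ H) (c : Chart s) (z : P2) :
    gg (fun z => F₁ (s z)) e1 e1 z * qq F₁ F₂ ν₁ ν₂ s e2 e2 z
      + gg (fun z => F₁ (s z)) e2 e2 z * qq F₁ F₂ ν₁ ν₂ s e1 e1 z
      - 2 * gg (fun z => F₁ (s z)) e1 e2 z * qq F₁ F₂ ν₁ ν₂ s e1 e2 z = 0 := by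
  have k1 := mean_eq P.h1 P.c1 P.m1 c z
  have k2 := mean_eq P.h2 P.c2 P.m2 c z
  simp only [← P.hg c] at k1 k2
  unfold qq
  linarith

end Pair

lemma stereo_inv (a b p : E3) (z : P2) (k : ℝ) (hz : z ≠ 0) (hk : k = (z.1 ^ 2 + z.2 ^ 2)⁻¹) :
    stereo a b p z = stereo a b (-p) (k * z.1, k * z.2) ∧
    pd e1 (stereo a b p) z = (k ^ 2 * (z.2 ^ 2 - z.1 ^ 2)) • pd e1 (stereo a b (-p)) (k * z.1, k * z.2)
      + (k ^ 2 * (-2 * (z.1 * z.2))) • pd e2 (stereo a b (-p)) (k * z.1, k * z.2) ∧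
    pd e2 (stereo a b p) z = (k ^ 2 * (-2 * (z.1 * z.2))) • pd e1 (stereo a b (-p)) (k * z.1, k * z.2)
      + (-(k ^ 2 * (z.2 ^ 2 - z.1 ^ 2))) • pd e2 (stereo a b (-p)) (k * z.1, k * z.2) := by
  obtain ⟨x, y⟩ := z
  simp only at hk
  have hr : 0 < x ^ 2 + y ^ 2 := by
    by_contra h
    push Not at h
    apply hz
    have h1 : x = 0 := by nlinarith [sq_nonneg x, sq_nonneg y]
    have h2 : y = 0 := by nlinarith [sq_nonneg x, sq_nonneg y]
    rw [h1, h2]; rfl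
  have hR : 0 < 1 + x ^ 2 + y ^ 2 := by linarith
  have hK : 1 + (k * x) ^ 2 + (k * y) ^ 2 = (1 + x ^ 2 + y ^ 2) * (x ^ 2 + y ^ 2)⁻¹ := by
    rw [hk]; field_simp; ring
  refine ⟨?_, ?_, ?_⟩
  · simp only [stereo, hK, smul_neg, ← neg_smul]
    rw [hk]
    congr 2
    · congr 1; field_simp
    · congr 1; field_simp
    · field_simp; ring
  · simp only [pd_stereo, hK, e1, e2, smul_neg, ← neg_smul, smul_add, smul_smul]
    rw [hk]
    match_scalars
    · field_simp; ring
    · field_simp; ring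
    · field_simp; ring
  · simp only [pd_stereo, hK, e1, e2, smul_neg, ← neg_smul, smul_add, smul_smul]
    rw [hk]
    match_scalars
    · field_simp; ring
    · field_simp; ring
    · field_simp; ring

open Pair in
lemma qq_inv {F₁ F₂ ν₁ ν₂ : E3 → E3} {H : E3 → ℝ} (P : Pair F₁ F₂ ν₁ ν₂ H) {a b p : E3} (h : ON a b p)
    (z : P2) (k α β : ℝ) (hz : z ≠ 0) (hk : k = (z.1 ^ 2 + z.2 ^ 2)⁻¹)
    (hα : α = k ^ 2 * (z.2 ^ 2 - z.1 ^ 2)) (hβ : β = k ^ 2 * (-2 * (z.1 * z.2))) :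
    qq F₁ F₂ ν₁ ν₂ (stereo a b p) e1 e1 z =
      α ^ 2 * qq F₁ F₂ ν₁ ν₂ (stereo a b (-p)) e1 e1 (k * z.1, k * z.2)
      + 2 * (α * β) * qq F₁ F₂ ν₁ ν₂ (stereo a b (-p)) e1 e2 (k * z.1, k * z.2)
      + β ^ 2 * qq F₁ F₂ ν₁ ν₂ (stereo a b (-p)) e2 e2 (k * z.1, k * z.2) ∧
    qq F₁ F₂ ν₁ ν₂ (stereo a b p) e1 e2 z =
      α * β * (qq F₁ F₂ ν₁ ν₂ (stereo a b (-p)) e1 e1 (k * z.1, k * z.2)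
        - qq F₁ F₂ ν₁ ν₂ (stereo a b (-p)) e2 e2 (k * z.1, k * z.2))
      + (β ^ 2 - α ^ 2) * qq F₁ F₂ ν₁ ν₂ (stereo a b (-p)) e1 e2 (k * z.1, k * z.2) := by
  obtain ⟨i0, i1, i2⟩ := stereo_inv a b p z k hz hk
  have c := stereo_chart h
  have c' := stereo_chart h.neg
  rw [← hα, ← hβ] at i1 i2
  have cm := P.qq_comm c' e2 e1 (k * z.1, k * z.2)
  simp only [P.qq_eq c'] at cm ⊢
  rw [P.qq_eq c, P.qq_eq c, i0, i1, i2]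
  simp only [sff_bil P.h1.1, sff_bil P.h2.1]
  constructor
  · linear_combination (α * β) * cm
  · linear_combination (β ^ 2) * cm

open Pair in
lemma q_zero {F₁ F₂ ν₁ ν₂ : E3 → E3} {H : E3 → ℝ} (P : Pair F₁ F₂ ν₁ ν₂ H) {a b p : E3} (h : ON a b p) :
    qq F₁ F₂ ν₁ ν₂ (stereo a b (-p)) e1 e1 0 = 0 ∧ qq F₁ F₂ ν₁ ν₂ (stereo a b (-p)) e1 e2 0 = 0 ∧
    qq F₁ F₂ ν₁ ν₂ (stereo a b (-p)) e2 e2 0 = 0 := by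
  have c := stereo_chart h
  have c' := stereo_chart h.neg
  have tr := P.htr c' 0
  have hD : 0 < gg (fun z => F₁ (stereo a b (-p) z)) e1 e1 0 * gg (fun z => F₁ (stereo a b (-p) z)) e2 e2 0
    - gg (fun z => F₁ (stereo a b (-p) z)) e1 e2 0 ^ 2 := (P.S1 c').hD 0
  have hE : 0 ≤ gg (fun z => F₁ (stereo a b (-p) z)) e1 e1 0 := real_inner_self_nonneg
  by_cases hdet : qq F₁ F₂ ν₁ ν₂ (stereo a b (-p)) e1 e1 0 * qq F₁ F₂ ν₁ ν₂ (stereo a b (-p)) e2 e2 0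
      - qq F₁ F₂ ν₁ ν₂ (stereo a b (-p)) e1 e2 0 ^ 2 < 0
  · exfalso
    obtain ⟨R, hR, hpos⟩ := asym (P.qq_sm c e1 e1) (P.qq_sm c e1 e2) (P.qq_sm c' e1 e1) (P.qq_sm c' e1 e2)
      (P.qq_sm c' e2 e2) (fun z k α β h1 h2 h3 h4 => (qq_inv P h z k α β h1 h2 h3 h4).1)
      (fun z k α β h1 h2 h3 h4 => (qq_inv P h z k α β h1 h2 h3 h4).2) hdet
    obtain ⟨C, hC, hb⟩ := jac_bound (P.S1 c) (P.S2 c) (P.hg c) (P.htr c)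
    obtain ⟨C0, hC0⟩ := (isCompact_closedBall (0 : P2) (R + 2)).exists_bound_of_continuousOn hC.continuousOn
    refine winding_contra (P.qq_sm c e1 e1) (P.qq_sm c e1 e2) (C := C0) hR ?_ hpos
    intro z hz
    have hmem : z ∈ Metric.closedBall (0 : P2) (R + 2) := by
      rw [mem_closedBall_zero_iff, Prod.norm_def, max_le_iff]
      constructor
      · exact abs_le_of_sq_le_sq (by nlinarith [sq_nonneg z.2]) (by linarith)
      · exact abs_le_of_sq_le_sq (by nlinarith [sq_nonneg z.1]) (by linarith)
    refine (hb z).trans ?_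
    refine mul_le_mul_of_nonneg_right ((le_abs_self _).trans (hC0 z hmem)) (by positivity)
  · set E := gg (fun z => F₁ (stereo a b (-p) z)) e1 e1 0
    set F := gg (fun z => F₁ (stereo a b (-p) z)) e1 e2 0
    set G := gg (fun z => F₁ (stereo a b (-p) z)) e2 e2 0
    set x := qq F₁ F₂ ν₁ ν₂ (stereo a b (-p)) e1 e1 0
    set y := qq F₁ F₂ ν₁ ν₂ (stereo a b (-p)) e1 e2 0
    set t := qq F₁ F₂ ν₁ ν₂ (stereo a b (-p)) e2 e2 0
    push Not at hdet
    have hE' : 0 < E := by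
      rcases hE.lt_or_eq with h | h
      · exact h
      · rw [← h] at hD; nlinarith [sq_nonneg F]
    have id : E ^ 2 * (x * t - y ^ 2) = -(E * y - F * x) ^ 2 - (E * G - F ^ 2) * x ^ 2 := by
      linear_combination (E * x) * tr
    have hpos : 0 ≤ E ^ 2 * (x * t - y ^ 2) := by positivity
    have hx2 : (E * G - F ^ 2) * x ^ 2 = 0 := by
      have : 0 ≤ (E * G - F ^ 2) * x ^ 2 := by positivity
      nlinarith [sq_nonneg (E * y - F * x)]
    have hx : x = 0 := by
      rcases mul_eq_zero.1 hx2 with h | h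
      · exact absurd h hD.ne'
      · exact pow_eq_zero_iff (two_ne_zero) |>.1 h
    rw [hx] at id tr hpos
    have hy : y = 0 := by
      have h1 : E ^ 2 * y ^ 2 ≤ 0 := by nlinarith
      have : (E * y) ^ 2 = 0 := le_antisymm (by nlinarith) (sq_nonneg _)
      have := pow_eq_zero_iff (two_ne_zero) |>.1 this
      exact (mul_eq_zero.1 this).resolve_left hE'.ne'
    rw [hy] at tr
    refine ⟨hx, hy, ?_⟩
    have : E * t = 0 := by linarith
    exact (mul_eq_zero.1 this).resolve_left hE'.ne'

lemma stereo_zero (a b p : E3) : stereo a b (-p) 0 = p := by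
  simp [stereo]; norm_num

lemma pd_stereo_zero (a b p : E3) : pd e1 (stereo a b (-p)) 0 = (2 : ℝ) • a ∧ pd e2 (stereo a b (-p)) 0 = (2 : ℝ) • b := by
  constructor <;> rw [pd_stereo] <;> simp [e1, e2]

open Pair in
lemma sff_same {F₁ F₂ ν₁ ν₂ : E3 → E3} {H : E3 → ℝ} (P : Pair F₁ F₂ ν₁ ν₂ H) {a b p : E3} (h : ON a b p) :
    sff F₁ p (ν₁ p) a a = sff F₂ p (ν₂ p) a a ∧ sff F₁ p (ν₁ p) a b = sff F₂ p (ν₂ p) a b ∧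
    sff F₁ p (ν₁ p) b b = sff F₂ p (ν₂ p) b b := by
  have c' := stereo_chart h.neg
  have k := q_zero P h
  obtain ⟨p1, p2⟩ := pd_stereo_zero a b p
  simp only [P.qq_eq c', p1, p2, stereo_zero, sff_smul P.h1.1, sff_smul P.h2.1] at k
  refine ⟨?_, ?_, ?_⟩ <;> linarith [k.1, k.2.1, k.2.2]

open Pair in
lemma AA_same {F₁ F₂ ν₁ ν₂ : E3 → E3} {H : E3 → ℝ} (P : Pair F₁ F₂ ν₁ ν₂ H) {s : P2 → E3} (c : Chart s) (z : P2) :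
    qq F₁ F₂ ν₁ ν₂ s e1 e1 z = 0 ∧ qq F₁ F₂ ν₁ ν₂ s e1 e2 z = 0 ∧ qq F₁ F₂ ν₁ ν₂ s e2 e2 z = 0 := by
  set L := √⟪pd e1 s z, pd e1 s z⟫ with hL
  have hLp : 0 < L := Real.sqrt_pos.2 (c.s11 z)
  have hLL : ⟪pd e1 s z, pd e1 s z⟫ = L * L := (Real.mul_self_sqrt (c.s11 z).le).symm
  have on : ON (L⁻¹ • pd e1 s z) (L⁻¹ • pd e2 s z) (s z) := by
    constructor <;> simp only [real_inner_smul_left, real_inner_smul_right, c.s1, c.s12, c.s22, hLL, mul_zero]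
    · field_simp
    · field_simp
    · rw [real_inner_comm, c.tang, mul_zero]
    · rw [real_inner_comm, c.tang, mul_zero]
  have k := sff_same P on
  simp only [sff_smul P.h1.1, sff_smul P.h2.1] at k
  have hi : L⁻¹ * L⁻¹ ≠ 0 := by positivity
  simp only [P.qq_eq c]
  refine ⟨?_, ?_, ?_⟩
  · rw [mul_left_cancel₀ hi k.1, sub_self]
  · rw [mul_left_cancel₀ hi k.2.1, sub_self]
  · rw [mul_left_cancel₀ hi k.2.2, sub_self]

end BP

namespace BP
open MeasureTheory Filter Topology

/-- Gram determinant inverse. -/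
def di (f : P2 → E3) (z : P2) : ℝ := (gg f e1 e1 z * gg f e2 e2 z - gg f e1 e2 z ^ 2)⁻¹
def k1 (f : P2 → E3) (w : E3) (z : P2) : ℝ :=
  di f z * (gg f e2 e2 z * ⟪w, pd e1 f z⟫ - gg f e1 e2 z * ⟪w, pd e2 f z⟫)
def k2 (f : P2 → E3) (w : E3) (z : P2) : ℝ :=
  di f z * (gg f e1 e1 z * ⟪w, pd e2 f z⟫ - gg f e1 e2 z * ⟪w, pd e1 f z⟫)
/-- The transported vector. -/
def uu (f n f' n' : P2 → E3) (w : E3) (z : P2) : E3 :=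
  (k1 f w z • pd e1 f' z + k2 f w z • pd e2 f' z) + ⟪w, n z⟫ • n' z

lemma pd_smul {φ : P2 → ℝ} {X : P2 → E3} (h : Sm φ) (hX : Sm X) (v z : P2) :
    pd v (fun z => φ z • X z) z = pd v φ z • X z + φ z • pd v X z := by
  unfold pd
  rw [fderiv_fun_smul (h.da z) (hX.da z)]
  simp [add_comm]

lemma cst_sm (w : E3) : Sm (fun _ : P2 => w) := contDiff_const

section
variable {f n f' n' : P2 → E3}

lemma di_sm (S : Surf f n) : Sm (di f) := by
  have : Sm (fun z => gg f e1 e1 z * gg f e2 e2 z - gg f e1 e2 z ^ 2) :=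
    ((gg_sm S.hf _ _).mul (gg_sm S.hf _ _)).sub ((gg_sm S.hf _ _).pow 2)
  exact this.inv (fun z => (S.hD z).ne')

lemma k1_sm (S : Surf f n) (w : E3) : Sm (k1 f w) :=
  (di_sm S).mul (((gg_sm S.hf _ _).mul ((cst_sm w).inner (S.hf.pd e1))).sub
    ((gg_sm S.hf _ _).mul ((cst_sm w).inner (S.hf.pd e2))))
lemma k2_sm (S : Surf f n) (w : E3) : Sm (k2 f w) :=
  (di_sm S).mul (((gg_sm S.hf _ _).mul ((cst_sm w).inner (S.hf.pd e2))).sub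
    ((gg_sm S.hf _ _).mul ((cst_sm w).inner (S.hf.pd e1))))

lemma uu_self (S : Surf f n) (w : E3) (z : P2) : uu f n f n w z = w := by
  have hD := (S.hD z).ne'
  have hD' : gg f e1 e1 z * gg f e2 e2 z - gg f e1 e2 z ^ 2 ≠ 0 := hD
  rw [eq_comm, ← sub_eq_zero]
  have c12 : ⟪pd e2 f z, pd e1 f z⟫ = gg f e1 e2 z := real_inner_comm _ _
  have d11 : ⟪pd e1 f z, pd e1 f z⟫ = gg f e1 e1 z := rfl
  have d22 : ⟪pd e2 f z, pd e2 f z⟫ = gg f e2 e2 z := rfl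
  have d12 : ⟪pd e1 f z, pd e2 f z⟫ = gg f e1 e2 z := rfl
  apply ortho_zero (S.n1 z) (S.nf1 z) (S.nf2 z) hD
  · simp only [uu, inner_sub_left, inner_add_left, real_inner_smul_left, S.nf1, c12, d11, k1, k2, di]
    field_simp; ring
  · simp only [uu, inner_sub_left, inner_add_left, real_inner_smul_left, S.nf2, d12, d22, k1, k2, di]
    field_simp; ring
  · simp only [uu, inner_sub_left, inner_add_left, real_inner_smul_left, S.n1,
      real_inner_comm (n z) (pd e1 f z), real_inner_comm (n z) (pd e2 f z), S.nf1, S.nf2]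
    ring

lemma pd_uu (S : Surf f n) (S' : Surf f' n') (w : E3) (v z : P2) : pd v (uu f n f' n' w) z =
    ((pd v (k1 f w) z • pd e1 f' z + k1 f w z • pd v (pd e1 f') z)
      + (pd v (k2 f w) z • pd e2 f' z + k2 f w z • pd v (pd e2 f') z))
      + (⟪w, pd v n z⟫ • n' z + ⟪w, n z⟫ • pd v n' z) := by
  have a1 : Sm (fun z => k1 f w z • pd e1 f' z) := (k1_sm S w).smul (S'.hf.pd e1)
  have a2 : Sm (fun z => k2 f w z • pd e2 f' z) := (k2_sm S w).smul (S'.hf.pd e2)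
  have i3 : Sm (fun z => ⟪w, n z⟫) := (cst_sm w).inner S.hn
  have a3 : Sm (fun z => ⟪w, n z⟫ • n' z) := i3.smul S'.hn
  have d3 : pd v (fun z => ⟪w, n z⟫) z = ⟪w, pd v n z⟫ := by
    have := pd_inner (cst_sm w) S.hn v z
    rw [this, pd_const, inner_zero_left, zero_add]
  have := pd_add (a1.add a2) a3 v z
  rw [pd_add a1 a2, pd_smul (k1_sm S w) (S'.hf.pd e1), pd_smul (k2_sm S w) (S'.hf.pd e2),
    pd_smul i3 S'.hn, d3] at this
  exact this

lemma uu_const (S : Surf f n) (S' : Surf f' n') (hg : ∀ v w, gg f v w = gg f' v w)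
    (hA : ∀ v w, (v = e1 ∨ v = e2) → (w = e1 ∨ w = e2) → AA f n v w = AA f' n' v w)
    (w : E3) (v z : P2) (hv : v = e1 ∨ v = e2) : pd v (uu f n f' n' w) z = 0 := by
  have hT : ∀ u v w z, TT f' u v w z = TT f u v w z := by
    intro u v w z
    have h1 := koszul S.hf u v w z
    have h2 := koszul S'.hf u v w z
    simp only [hg] at h1
    linarith
  have h0 : pd v (uu f n f n w) z = 0 := by
    rw [funext (uu_self S w), pd_const]
  rw [pd_uu S S] at h0
  rw [pd_uu S S']
  set α := pd v (k1 f w) z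
  set β := pd v (k2 f w) z
  set a := k1 f w z
  set b := k2 f w z
  set c := ⟪w, pd v n z⟫
  set d := ⟪w, n z⟫
  have g11 : ⟪pd e1 f' z, pd e1 f' z⟫ = ⟪pd e1 f z, pd e1 f z⟫ := (congrFun (hg e1 e1) z).symm
  have g12 : ⟪pd e1 f' z, pd e2 f' z⟫ = ⟪pd e1 f z, pd e2 f z⟫ := (congrFun (hg e1 e2) z).symm
  have g21 : ⟪pd e2 f' z, pd e1 f' z⟫ = ⟪pd e2 f z, pd e1 f z⟫ := (congrFun (hg e2 e1) z).symm
  have g22 : ⟪pd e2 f' z, pd e2 f' z⟫ = ⟪pd e2 f z, pd e2 f z⟫ := (congrFun (hg e2 e2) z).symm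
  have t : ∀ i j, ⟪pd v (pd j f') z, pd i f' z⟫ = ⟪pd v (pd j f) z, pd i f z⟫ := by
    intro i j
    rw [real_inner_comm, real_inner_comm (pd i f z)]; exact hT i j v z
  have nn : ∀ j, (j = e1 ∨ j = e2) → ⟪pd v (pd j f') z, n' z⟫ = ⟪pd v (pd j f) z, n z⟫ := by
    intro j hj
    rw [real_inner_comm, real_inner_comm (n z)]; exact (congrFun (hA j v hj hv) z).symm
  have w1 : ⟪pd v n' z, pd e1 f' z⟫ = ⟪pd v n z, pd e1 f z⟫ := by
    rw [S.wein1, S'.wein1, hA e1 v (Or.inl rfl) hv]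
  have w2 : ⟪pd v n' z, pd e2 f' z⟫ = ⟪pd v n z, pd e2 f z⟫ := by
    rw [S.wein2, S'.wein2, hA e2 v (Or.inr rfl) hv]
  have n1 : ⟪n' z, pd e1 f' z⟫ = ⟪n z, pd e1 f z⟫ := by rw [S.nf1, S'.nf1]
  have n2 : ⟪n' z, pd e2 f' z⟫ = ⟪n z, pd e2 f z⟫ := by rw [S.nf2, S'.nf2]
  have n3 : ⟪n' z, n' z⟫ = ⟪n z, n z⟫ := by rw [S.n1, S'.n1]
  have n4 : ⟪pd v n' z, n' z⟫ = ⟪pd v n z, n z⟫ := by rw [S.dn_n, S'.dn_n]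
  have n5 : ⟪pd e1 f' z, n' z⟫ = ⟪pd e1 f z, n z⟫ := by rw [real_inner_comm, n1, real_inner_comm]
  have n6 : ⟪pd e2 f' z, n' z⟫ = ⟪pd e2 f z, n z⟫ := by rw [real_inner_comm, n2, real_inner_comm]
  apply ortho_zero (S'.n1 z) (S'.nf1 z) (S'.nf2 z) (S'.hD z).ne'
  · have h := congrArg (fun t => ⟪t, pd e1 f z⟫) h0
    simp only [inner_add_left, real_inner_smul_left, inner_zero_left] at h ⊢
    rw [g11, g21, t, t, w1, n1]; exact h
  · have h := congrArg (fun t => ⟪t, pd e2 f z⟫) h0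
    simp only [inner_add_left, real_inner_smul_left, inner_zero_left] at h ⊢
    rw [g12, g22, t, t, w2, n2]; exact h
  · have h := congrArg (fun t => ⟪t, n z⟫) h0
    simp only [inner_add_left, real_inner_smul_left, inner_zero_left] at h ⊢
    rw [n5, n6, nn e1 (Or.inl rfl), nn e2 (Or.inr rfl), n3, n4]; exact h

lemma const_of_pd {g : P2 → E3} (hg : Sm g) (h1 : ∀ z, pd e1 g z = 0) (h2 : ∀ z, pd e2 g z = 0) (z : P2) :
    g z = g 0 := by
  apply is_const_of_fderiv_eq_zero (𝕜 := ℝ) (hg.differentiable (by simp))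
  intro z
  apply ContinuousLinearMap.ext; intro v
  have : v = v.1 • e1 + v.2 • e2 := by simp [e1, e2]
  rw [this, map_add, map_smul, map_smul]
  have a : fderiv ℝ g z e1 = 0 := h1 z
  have b : fderiv ℝ g z e2 = 0 := h2 z
  rw [a, b]; simp

lemma uu_sm (S : Surf f n) (S' : Surf f' n') (w : E3) : Sm (uu f n f' n' w) := by
  have i3 : Sm (fun z => ⟪w, n z⟫) := (cst_sm w).inner S.hn
  exact (((k1_sm S w).smul (S'.hf.pd e1)).add ((k2_sm S w).smul (S'.hf.pd e2))).add (i3.smul S'.hn)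

lemma congr_chart (S : Surf f n) (S' : Surf f' n') (hg : ∀ v w, gg f v w = gg f' v w)
    (hA : ∀ v w, (v = e1 ∨ v = e2) → (w = e1 ∨ w = e2) → AA f n v w = AA f' n' v w) :
    ∃ Φ : E3 ≃ᵢ E3, ∀ z, f' z = Φ (f z) := by
  have uc : ∀ w z, uu f n f' n' w z = uu f n f' n' w 0 := fun w z =>
    const_of_pd (uu_sm S S' w) (fun z => uu_const S S' hg hA w e1 z (Or.inl rfl))
      (fun z => uu_const S S' hg hA w e2 z (Or.inr rfl)) z
  let O : E3 →ₗ[ℝ] E3 :=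
    { toFun := fun w => uu f n f' n' w 0
      map_add' := by
        intro x y
        simp only [uu, k1, k2, inner_add_left]
        module
      map_smul' := by
        intro r x
        simp only [uu, k1, k2, real_inner_smul_left, RingHom.id_apply]
        module }
  have hO : ∀ w z, O w = uu f n f' n' w z := fun w z => (uc w z).symm
  have hinner : ∀ w, ⟪O w, O w⟫ = ⟪w, w⟫ := by
    intro w
    have e : ⟪uu f n f n w 0, uu f n f n w 0⟫ = ⟪w, w⟫ := by rw [uu_self S]
    rw [hO w 0, ← e]
    have g11 : ⟪pd e1 f' 0, pd e1 f' 0⟫ = ⟪pd e1 f 0, pd e1 f 0⟫ := (congrFun (hg e1 e1) 0).symm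
    have g12 : ⟪pd e1 f' 0, pd e2 f' 0⟫ = ⟪pd e1 f 0, pd e2 f 0⟫ := (congrFun (hg e1 e2) 0).symm
    have g21 : ⟪pd e2 f' 0, pd e1 f' 0⟫ = ⟪pd e2 f 0, pd e1 f 0⟫ := (congrFun (hg e2 e1) 0).symm
    have g22 : ⟪pd e2 f' 0, pd e2 f' 0⟫ = ⟪pd e2 f 0, pd e2 f 0⟫ := (congrFun (hg e2 e2) 0).symm
    simp only [uu, inner_add_left, inner_add_right, real_inner_smul_left, real_inner_smul_right,
      g11, g12, g21, g22, S.n1, S'.n1, S.nf1, S'.nf1, S.nf2, S'.nf2,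
      real_inner_comm (n 0) (pd e1 f 0), real_inner_comm (n 0) (pd e2 f 0),
      real_inner_comm (n' 0) (pd e1 f' 0), real_inner_comm (n' 0) (pd e2 f' 0)]
  let L : E3 →ₗᵢ[ℝ] E3 := ⟨O, fun w => by
    have h := hinner w
    rw [real_inner_self_eq_norm_sq, real_inner_self_eq_norm_sq] at h
    exact (sq_eq_sq₀ (norm_nonneg _) (norm_nonneg _)).1 h⟩
  have hO1 : ∀ z, O (pd e1 f z) = pd e1 f' z := by
    intro z
    have hD := (S.hD z).ne'
    have hD' : gg f e1 e1 z * gg f e2 e2 z - gg f e1 e2 z ^ 2 ≠ 0 := hD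
    have d11 : ⟪pd e1 f z, pd e1 f z⟫ = gg f e1 e1 z := rfl
    have d12 : ⟪pd e1 f z, pd e2 f z⟫ = gg f e1 e2 z := rfl
    rw [hO _ z]
    have a1 : k1 f (pd e1 f z) z = 1 := by
      simp only [k1, di, d11, d12]; field_simp
    have a2 : k2 f (pd e1 f z) z = 0 := by
      simp only [k2, di, d11, d12]; ring
    simp only [uu, a1, a2, real_inner_comm (n z) (pd e1 f z), S.nf1]; simp
  have hO2 : ∀ z, O (pd e2 f z) = pd e2 f' z := by
    intro z
    have hD := (S.hD z).ne'
    have hD' : gg f e1 e1 z * gg f e2 e2 z - gg f e1 e2 z ^ 2 ≠ 0 := hD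
    have d22 : ⟪pd e2 f z, pd e2 f z⟫ = gg f e2 e2 z := rfl
    have d12 : ⟪pd e2 f z, pd e1 f z⟫ = gg f e1 e2 z := real_inner_comm _ _
    rw [hO _ z]
    have a1 : k1 f (pd e2 f z) z = 0 := by
      simp only [k1, di, d22, d12]; ring
    have a2 : k2 f (pd e2 f z) z = 1 := by
      simp only [k2, di, d22, d12]; field_simp
    simp only [uu, a1, a2, real_inner_comm (n z) (pd e2 f z), S.nf2]; simp
  have sOf : Sm (fun z => L.toContinuousLinearMap (f z)) := L.toContinuousLinearMap.contDiff.comp S.hf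
  have pOf : ∀ v z, pd v (fun z => L.toContinuousLinearMap (f z)) z = O (pd v f z) := by
    intro v z
    have := (L.toContinuousLinearMap.hasFDerivAt.comp z (S.hf.da z).hasFDerivAt).fderiv
    exact congrArg (fun T : P2 →L[ℝ] E3 => T v) this
  have hc := const_of_pd (S'.hf.sub sOf)
    (fun z => by
      have := pd_sub S'.hf sOf e1 z
      rw [pOf, hO1, sub_self] at this; exact this)
    (fun z => by
      have := pd_sub S'.hf sOf e2 z
      rw [pOf, hO2, sub_self] at this; exact this)
  let T : E3 ≃ₗᵢ[ℝ] E3 := L.toLinearIsometryEquiv rfl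
  refine ⟨T.toIsometryEquiv.trans (IsometryEquiv.addRight (f' 0 - L (f 0))), ?_⟩
  intro z
  have h := hc z
  change f' z = L (f z) + (f' 0 - L (f 0))
  have h' : f' z - L (f z) = f' 0 - L (f 0) := h
  rw [← h']; abel

end

lemma sphere_cover {a b p : E3} (h : ON a b p) (x : E3) (hx : x ∈ S2) :
    x = p ∨ ∃ z, x = stereo a b p z := by
  have hx1 : ⟪x, x⟫ = 1 := by
    rw [real_inner_self_eq_norm_sq]
    simp only [S2, mem_sphere_iff_norm, sub_zero] at hx
    rw [hx]; norm_num
  set α := ⟪x, a⟫ with hα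
  set β := ⟪x, b⟫ with hβ
  set γ := ⟪x, p⟫ with hγ
  have pa : ⟪p, a⟫ = 0 := by rw [real_inner_comm]; exact h.ap
  have pb : ⟪p, b⟫ = 0 := by rw [real_inner_comm]; exact h.bp
  have ba : ⟪b, a⟫ = 0 := by rw [real_inner_comm]; exact h.ab
  have ex : x = α • a + β • b + γ • p := by
    rw [← sub_eq_zero]
    apply ortho_zero h.pp pa pb (by rw [h.aa, h.bb, h.ab]; norm_num)
    · simp only [inner_sub_left, inner_add_left, real_inner_smul_left, h.aa, ba, pa]; ring
    · simp only [inner_sub_left, inner_add_left, real_inner_smul_left, h.ab, h.bb, pb]; ring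
    · simp only [inner_sub_left, inner_add_left, real_inner_smul_left, h.ap, h.bp, h.pp]; ring
  have hsq : α * α + β * β + γ * γ = 1 := by
    rw [← h.inner, ← ex, hx1]
  by_cases hg : γ = 1
  · left
    rw [hg] at hsq
    have h1 : α = 0 := by nlinarith [mul_self_nonneg α, mul_self_nonneg β]
    have h2 : β = 0 := by nlinarith [mul_self_nonneg α, mul_self_nonneg β]
    rw [ex, h1, h2, hg]; simp
  · right
    have h1 : 1 - γ ≠ 0 := fun h => hg (by linarith)
    refine ⟨(α / (1 - γ), β / (1 - γ)), ?_⟩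
    have hρ : (1 + (α / (1 - γ)) ^ 2 + (β / (1 - γ)) ^ 2)⁻¹ = (1 - γ) / 2 := by
      have : 1 + (α / (1 - γ)) ^ 2 + (β / (1 - γ)) ^ 2 = 2 / (1 - γ) := by
        field_simp; linear_combination hsq
      rw [this, inv_div]
    unfold stereo
    simp only [hρ]
    rw [ex]
    congr 2
    · congr 1; field_simp
    · congr 1; field_simp
    · ring

lemma main {F₁ F₂ ν₁ ν₂ : E3 → E3} {H : E3 → ℝ} (P : Pair F₁ F₂ ν₁ ν₂ H) :
    ∃ Φ : E3 ≃ᵢ E3, ∀ x ∈ S2, F₂ x = Φ (F₁ x) := by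
  let a : E3 := !₂[1, 0, 0]
  let b : E3 := !₂[0, 1, 0]
  let p : E3 := !₂[0, 0, 1]
  have h : ON a b p := by
    constructor <;> rw [inner3] <;> simp [a, b, p]
  have c := stereo_chart h
  have c' := stereo_chart h.neg
  obtain ⟨Φ, hΦ⟩ := congr_chart (P.S1 c) (P.S2 c) (P.hg c) (by
    intro v w hv hw
    ext z
    obtain ⟨q1, q2, q3⟩ := AA_same P c z
    have q4 := q2
    rw [P.qq_comm c] at q4
    rcases hv with rfl | rfl <;> rcases hw with rfl | rfl
    · exact sub_eq_zero.1 q1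
    · exact sub_eq_zero.1 q2
    · exact sub_eq_zero.1 q4
    · exact sub_eq_zero.1 q3)
  refine ⟨Φ, ?_⟩
  have hhat : (fun z => F₂ (stereo a b (-p) z)) = fun z => Φ (F₁ (stereo a b (-p) z)) := by
    apply Continuous.ext_on (dense_compl_singleton (0 : P2))
    · exact (P.S2 c').hf.continuous
    · exact Φ.continuous.comp (P.S1 c').hf.continuous
    · intro z hz
      obtain ⟨i0, -, -⟩ := stereo_inv a b (-p) z _ hz rfl
      rw [neg_neg] at i0
      simp only
      rw [i0]
      exact hΦ _
  intro x hx
  rcases sphere_cover h x hx with rfl | ⟨z, rfl⟩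
  · have := congrFun hhat 0
    simp only [stereo_zero] at this
    exact this
  · exact hΦ z

end BP

/-- Let `F₁, F₂ : S² → ℝ³` be smooth immersions with the same induced
metric and the same mean curvature (a Bonnet pair of spherical topology). Then `F₁` and
`F₂` are congruent: `F₂ = Φ ∘ F₁` on `S²` for some rigid motion `Φ` of `ℝ³`. -/
theorem bonnet_pair_congruent
    (F₁ F₂ : E3 → E3) (ν₁ ν₂ : E3 → E3) (H : E3 → ℝ)
    (h₁ : IsImmersionOnSphere F₁) (h₂ : IsImmersionOnSphere F₂)
    (hν₁ : Continuous ν₁) (hν₂ : Continuous ν₂)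
    (hmet : ∀ x ∈ S2, ∀ v w : E3, Tang x v → Tang x w →
      inducedMetric F₁ x v w = inducedMetric F₂ x v w)
    (hH₁ : ∀ x ∈ S2, IsMeanCurvAt F₁ x (ν₁ x) (H x))
    (hH₂ : ∀ x ∈ S2, IsMeanCurvAt F₂ x (ν₂ x) (H x)) :
    ∃ Φ : E3 ≃ᵢ E3, ∀ x ∈ S2, F₂ x = Φ (F₁ x) := by
  exact BP.main ⟨h₁, h₂, hν₁, hν₂, hmet, hH₁, hH₂⟩
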